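/- Comparison principle for the system of variational inequalities with inter-connected obstacles: if (u_1,…,u_m) is a viscosity subsolution and (w_1,…,w_m) is a viscosity supersolution of the system min{v_i(t,x) − max_{j≠i}(−g_ij(t,x)+v_j(t,x)), −∂_t v_i(t,x) − A v_i(t,x) − ψ_i(t,x)} = 0 (i ∈ I), with v_i(T,·) ≡ 0, and both m-tuples belong to the class C of continuous functions of polynomial growth, then u_i(t,x) ≤ w_i(t,x) for every i ∈ I and every (t,x) ∈ [0,T]×ℝ^k. -/

import Mathlib

open Set

noncomputable section

namespace SwitchingPDE

/-- Maximum of `f` over the indices `j ≠ i` (the inter-connected obstacle). -/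
def maxNe {m : ℕ} (i : Fin m) (f : Fin m → ℝ) : ℝ :=
  ⨆ j : {j : Fin m // j ≠ i}, f (j : Fin m)

variable {k d m : ℕ}

/-- The second order operator
`Aφ(t,x) = (1/2) Tr[σ(t,x)σ(t,x)* D²_{xx}φ(t,x)] + ⟨b(t,x), D_xφ(t,x)⟩`. -/
def opA (σ : ℝ → EuclideanSpace ℝ (Fin k) → Fin k → Fin d → ℝ)
    (b : ℝ → EuclideanSpace ℝ (Fin k) → EuclideanSpace ℝ (Fin k))
    (φ : ℝ × EuclideanSpace ℝ (Fin k) → ℝ) (t : ℝ) (x : EuclideanSpace ℝ (Fin k)) : ℝ :=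
  (1 / 2) * ∑ p : Fin k, ∑ q : Fin k, (∑ r : Fin d, σ t x p r * σ t x q r) *
      (fderiv ℝ (fun z : ℝ × EuclideanSpace ℝ (Fin k) =>
        fderiv ℝ φ z (0, EuclideanSpace.single q 1)) (t, x)) (0, EuclideanSpace.single p 1)
    + fderiv ℝ φ (t, x) (0, b t x)

/-- Time derivative `∂_t φ(t,x)` of a function of `(t,x)`. -/
def dt (φ : ℝ × EuclideanSpace ℝ (Fin k) → ℝ) (t : ℝ) (x : EuclideanSpace ℝ (Fin k)) : ℝ :=
  fderiv ℝ φ (t, x) (1, 0)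

/-- Viscosity supersolution of the system of variational inequalities with inter-connected
obstacles `min{v_i − max_{j≠i}(−g_{ij}+v_j), −∂_t v_i − A v_i − ψ_i} = 0`: whenever a smooth
test function `φ` touches `v_i` at `(t₀,x₀)` with a local maximum of `φ − v_i` on
`[0,T] × ℝ^k`, the corresponding expression is `≥ 0`. -/
def IsViscositySupersolution (T : ℝ)
    (σ : ℝ → EuclideanSpace ℝ (Fin k) → Fin k → Fin d → ℝ)
    (b : ℝ → EuclideanSpace ℝ (Fin k) → EuclideanSpace ℝ (Fin k))
    (ψ : Fin m → ℝ → EuclideanSpace ℝ (Fin k) → ℝ)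
    (g : Fin m → Fin m → ℝ → EuclideanSpace ℝ (Fin k) → ℝ)
    (v : Fin m → ℝ → EuclideanSpace ℝ (Fin k) → ℝ) : Prop :=
  ∀ i : Fin m, ∀ t₀ ∈ Ico (0 : ℝ) T, ∀ x₀ : EuclideanSpace ℝ (Fin k),
    ∀ φ : ℝ × EuclideanSpace ℝ (Fin k) → ℝ, ContDiff ℝ 2 φ →
      φ (t₀, x₀) = v i t₀ x₀ →
      IsLocalMaxOn (fun p : ℝ × EuclideanSpace ℝ (Fin k) => φ p - v i p.1 p.2)
        (Icc 0 T ×ˢ univ) (t₀, x₀) →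
      0 ≤ min (v i t₀ x₀ - maxNe i fun j => -(g i j t₀ x₀) + v j t₀ x₀)
          (-(dt φ t₀ x₀) - opA σ b φ t₀ x₀ - ψ i t₀ x₀)

/-- Viscosity subsolution: whenever a smooth test function `φ` touches `v_i` at `(t₀,x₀)`
with a local minimum of `φ − v_i` on `[0,T] × ℝ^k`, the corresponding expression is `≤ 0`. -/
def IsViscositySubsolution (T : ℝ)
    (σ : ℝ → EuclideanSpace ℝ (Fin k) → Fin k → Fin d → ℝ)
    (b : ℝ → EuclideanSpace ℝ (Fin k) → EuclideanSpace ℝ (Fin k))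
    (ψ : Fin m → ℝ → EuclideanSpace ℝ (Fin k) → ℝ)
    (g : Fin m → Fin m → ℝ → EuclideanSpace ℝ (Fin k) → ℝ)
    (v : Fin m → ℝ → EuclideanSpace ℝ (Fin k) → ℝ) : Prop :=
  ∀ i : Fin m, ∀ t₀ ∈ Ico (0 : ℝ) T, ∀ x₀ : EuclideanSpace ℝ (Fin k),
    ∀ φ : ℝ × EuclideanSpace ℝ (Fin k) → ℝ, ContDiff ℝ 2 φ →
      φ (t₀, x₀) = v i t₀ x₀ →
      IsLocalMinOn (fun p : ℝ × EuclideanSpace ℝ (Fin k) => φ p - v i p.1 p.2)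
        (Icc 0 T ×ˢ univ) (t₀, x₀) →
      min (v i t₀ x₀ - maxNe i fun j => -(g i j t₀ x₀) + v j t₀ x₀)
          (-(dt φ t₀ x₀) - opA σ b φ t₀ x₀ - ψ i t₀ x₀) ≤ 0

/-- Membership in the class `C` of continuous functions on `[0,T] × ℝ^k` of polynomial
growth. -/
def InClassC (T : ℝ) (v : ℝ → EuclideanSpace ℝ (Fin k) → ℝ) : Prop :=
  ContinuousOn (fun p : ℝ × EuclideanSpace ℝ (Fin k) => v p.1 p.2) (Icc 0 T ×ˢ univ) ∧
    ∃ C γ : ℝ, ∀ t ∈ Icc (0 : ℝ) T, ∀ x, |v t x| ≤ C * (1 + ‖x‖ ^ γ)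

/-- The standing hypotheses on the coefficients `b, σ` and the data `ψ, g` of the system of
variational inequalities with inter-connected obstacles. -/
structure PDEHyps (T α : ℝ)
    (σ : ℝ → EuclideanSpace ℝ (Fin k) → Fin k → Fin d → ℝ)
    (b : ℝ → EuclideanSpace ℝ (Fin k) → EuclideanSpace ℝ (Fin k))
    (ψ : Fin m → ℝ → EuclideanSpace ℝ (Fin k) → ℝ)
    (g : Fin m → Fin m → ℝ → EuclideanSpace ℝ (Fin k) → ℝ) : Prop where
  σ_cont : ∀ p r, ContinuousOn
    (fun q : ℝ × EuclideanSpace ℝ (Fin k) => σ q.1 q.2 p r) (Icc 0 T ×ˢ univ)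
  b_cont : ContinuousOn
    (fun q : ℝ × EuclideanSpace ℝ (Fin k) => b q.1 q.2) (Icc 0 T ×ˢ univ)
  lipschitz : ∃ C : ℝ, ∀ t ∈ Icc (0 : ℝ) T, ∀ x x' : EuclideanSpace ℝ (Fin k),
    (∑ p : Fin k, ∑ r : Fin d, |σ t x p r - σ t x' p r|) + ‖b t x - b t x'‖ ≤ C * ‖x - x'‖
  ψ_cont : ∀ i, ContinuousOn
    (fun p : ℝ × EuclideanSpace ℝ (Fin k) => ψ i p.1 p.2) (Icc 0 T ×ˢ univ)
  g_cont : ∀ i j, ContinuousOn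
    (fun p : ℝ × EuclideanSpace ℝ (Fin k) => g i j p.1 p.2) (Icc 0 T ×ˢ univ)
  poly_growth : ∃ C γ : ℝ, ∀ i j, ∀ t ∈ Icc (0 : ℝ) T, ∀ x,
    |ψ i t x| + |g i j t x| ≤ C * (1 + ‖x‖ ^ γ)
  g_diag : ∀ i, ∀ t ∈ Icc (0 : ℝ) T, ∀ x, g i i t x = 0
  g_nonneg : ∀ i j, ∀ t ∈ Icc (0 : ℝ) T, ∀ x, 0 ≤ g i j t x
  g_triangle : ∀ i j l, j ≠ i → l ≠ i → l ≠ j → ∀ t ∈ Icc (0 : ℝ) T, ∀ x,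
    g i l t x < g i j t x + g j l t x
  g_alpha : ∀ i j, i ≠ j → ∀ t ∈ Icc (0 : ℝ) T, ∀ x, α < g i j t x + g j i t x

section Convex

set_option linter.unusedSectionVars false

open MeasureTheory Filter Topology Module

variable {E : Type*} [NormedAddCommGroup E] [InnerProductSpace ℝ E] [FiniteDimensional ℝ E]

/-- `s` is a selection of subgradients of `f`, bounded by `R`. -/
def IsSubgrad (f : E → ℝ) (s : E → E) (R : ℝ) : Prop :=
  (∀ x y, f x + inner ℝ (s x) (y - x) ≤ f y) ∧ ∀ x, ‖s x‖ ≤ R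

lemma IsSubgrad.lipschitz {f : E → ℝ} {s : E → E} {R : ℝ} (h : IsSubgrad f s R) :
    LipschitzWith (Real.toNNReal R) f := by
  apply LipschitzWith.of_le_add_mul
  intro x y
  have h1 := h.1 x y
  have h2 := abs_real_inner_le_norm (s x) (y - x)
  have h3 := h.2 x
  have h4 : R ≤ (Real.toNNReal R : ℝ) := Real.le_coe_toNNReal R
  rw [dist_eq_norm, norm_sub_rev]
  have h5 := neg_le_of_abs_le h2
  have h6 : ‖s x‖ * ‖y - x‖ ≤ (Real.toNNReal R : ℝ) * ‖y - x‖ := by gcongr; linarith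
  linarith

lemma IsSubgrad.mono {f : E → ℝ} {s : E → E} {R : ℝ} (h : IsSubgrad f s R) (x y : E) :
    0 ≤ inner ℝ (s y - s x) (y - x) := by
  have h1 := h.1 x y
  have h2 := h.1 y x
  have : inner ℝ (s y) (x - y) = - inner ℝ (s y) (y - x) := by
    rw [← inner_neg_right, neg_sub]
  rw [inner_sub_left]
  linarith

lemma IsSubgrad.eq_grad {f : E → ℝ} {s : E → E} {R : ℝ} (h : IsSubgrad f s R) {x : E}
    {f' : E →L[ℝ] ℝ} (hf : HasFDerivAt f f' x) (v : E) : f' v = inner ℝ (s x) v := by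
  have h1 : IsLocalMin (fun y => f y - inner ℝ (s x) (y - x)) x := by
    apply Eventually.of_forall
    intro y
    have := h.1 x y
    simp only [sub_self, inner_zero_right]
    linarith
  have h2 : HasFDerivAt (fun y => f y - inner ℝ (s x) (y - x)) (f' - innerSL ℝ (s x)) x := by
    apply hf.sub
    have : HasFDerivAt (fun y => innerSL ℝ (s x) (y - x)) ((innerSL ℝ (s x)).comp
      (ContinuousLinearMap.id ℝ E)) x :=
      (innerSL ℝ (s x)).hasFDerivAt.comp x ((hasFDerivAt_id x).sub_const x)
    simpa using this
  have h3 := h1.hasFDerivAt_eq_zero h2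
  have h4 := congrArg (fun L => L v) h3
  simp at h4
  linarith

/-- at differentiability points, the subgradient selection is continuous -/
lemma IsSubgrad.continuousAt {f : E → ℝ} {s : E → E} {R : ℝ} (h : IsSubgrad f s R) {x : E}
    (hf : DifferentiableAt ℝ f x) : ContinuousAt s x := by
  obtain ⟨f', hf'⟩ := hf
  have hg := h.eq_grad hf'
  rw [Metric.continuousAt_iff]
  intro ε hε
  have h1 := hf'.isLittleO.def (show 0 < ε / 4 by positivity)
  rw [Metric.eventually_nhds_iff] at h1
  obtain ⟨ρ, hρ, h1⟩ := h1
  refine ⟨ρ / 2, by positivity, ?_⟩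
  intro x' hx'
  rw [dist_eq_norm] at hx' ⊢
  by_cases h0 : s x' - s x = 0
  · rw [h0]; simpa using hε
  have hn : 0 < ‖s x' - s x‖ := norm_pos_iff.2 h0
  set w : E := (ρ / 4 / ‖s x' - s x‖) • (s x' - s x) with hw
  have hwn : ‖w‖ = ρ / 4 := by
    rw [hw, norm_smul, Real.norm_of_nonneg (by positivity)]
    field_simp
  have h2 := h.1 x' (x' + w)
  have h3 := h.1 x x'
  have hd : ‖x' + w - x‖ < ρ := by
    calc ‖x' + w - x‖ = ‖(x' - x) + w‖ := by congr 1; abel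
      _ ≤ ‖x' - x‖ + ‖w‖ := norm_add_le _ _
      _ < ρ := by rw [hwn]; linarith
  have h4 := h1 (y := x' + w) (by rw [dist_eq_norm]; exact hd)
  rw [hg, Real.norm_eq_abs] at h4
  have h5 := (abs_le.1 h4).2
  have e1 : inner ℝ (s x) (x' + w - x) = inner ℝ (s x) (x' - x) + inner ℝ (s x) w := by
    rw [← inner_add_right]; congr 1; abel
  have e2 : inner ℝ (s x' - s x) w = ρ / 4 * ‖s x' - s x‖ := by
    rw [hw, inner_smul_right, real_inner_self_eq_norm_sq]; field_simp
  rw [inner_sub_left] at e2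
  rw [e1] at h5
  have e3 : x' + w - x' = w := by abel
  rw [e3] at h2
  have h6 : ρ / 4 * ‖s x' - s x‖ ≤ ε / 4 * ‖x' + w - x‖ := by linarith
  have h7 : ε / 4 * ‖x' + w - x‖ < ε / 4 * ρ := by gcongr
  nlinarith

lemma telescoping {φ : ℝ → ℝ} {K : ℝ}
    (h : ∀ a b, 0 ≤ a → a ≤ b → b ≤ 1 → φ b - φ a ≤ K * (b - a) ^ 2) : φ 1 ≤ φ 0 := by
  have hK : 0 ≤ K ∨ K < 0 := le_or_gt 0 K
  have key : ∀ n : ℕ, 0 < n → φ 1 - φ 0 ≤ K * (1 / (n : ℝ)) := by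
    intro n hn
    have hn' : (0 : ℝ) < n := by exact_mod_cast hn
    have : ∀ j : ℕ, j ≤ n → φ (j / n) - φ 0 ≤ j * (K * (1 / (n : ℝ)) ^ 2) := by
      intro j
      induction j with
      | zero => intro _; simp
      | succ j ih =>
        intro hj
        have h1 := ih (by omega)
        have hj' : ((j : ℝ) + 1) ≤ n := by exact_mod_cast hj
        have h2 := h (j / n) ((j + 1) / n) (by positivity) (by gcongr; linarith)
          (by rw [div_le_one hn']; exact hj')
        have e : ((j : ℝ) + 1) / n - j / n = 1 / n := by field_simp; ring
        rw [e] at h2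
        push_cast
        linarith
    have h1 := this n le_rfl
    rw [div_self hn'.ne'] at h1
    have : (n : ℝ) * (K * (1 / (n : ℝ)) ^ 2) = K * (1 / n) := by field_simp
    linarith
  have hlim : Tendsto (fun n : ℕ => K * (1 / ((n : ℝ) + 1))) atTop (𝓝 (K * 0)) :=
    tendsto_one_div_add_atTop_nhds_zero_nat.const_mul K
  have := ge_of_tendsto' hlim (a := K * 0) (b := φ 1 - φ 0) (fun n => by
    have := key (n + 1) (by omega)
    push_cast at this
    exact this)
  linarith

lemma IsSubgrad.expansion {f : E → ℝ} {s : E → E} {R : ℝ} (h : IsSubgrad f s R) {x : E}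
    {B : E →L[ℝ] E} (hs : HasFDerivAt s B x) {η : ℝ} (hη : 0 < η) :
    ∀ᶠ v in 𝓝 (0 : E), |f (x + v) - f x - inner ℝ (s x) v - (1 / 2) * inner ℝ (B v) v|
      ≤ η * ‖v‖ ^ 2 := by
  have h1 := hs.isLittleO.def hη
  rw [Metric.eventually_nhds_iff] at h1 ⊢
  obtain ⟨ρ, hρ, h1⟩ := h1
  refine ⟨ρ, hρ, ?_⟩
  intro v hv
  rw [dist_zero_right] at hv
  have hsb : ∀ τ : ℝ, 0 ≤ τ → τ ≤ 1 →
      |inner ℝ (s (x + τ • v)) v - inner ℝ (s x) v - τ * inner ℝ (B v) v| ≤ η * ‖v‖ ^ 2 := by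
    intro τ h0 h1'
    have hn : ‖τ • v‖ ≤ ‖v‖ := by
      rw [norm_smul, Real.norm_of_nonneg h0]
      nlinarith [norm_nonneg v]
    have h2 := h1 (y := x + τ • v) (by rw [dist_eq_norm]; simpa using lt_of_le_of_lt hn hv)
    rw [add_sub_cancel_left] at h2
    have h3 : inner ℝ (s (x + τ • v)) v - inner ℝ (s x) v - τ * inner ℝ (B v) v
      = inner ℝ (s (x + τ • v) - s x - B (τ • v)) v := by
      rw [inner_sub_left, inner_sub_left, map_smul, real_inner_smul_left]
    rw [h3]
    calc _ ≤ ‖s (x + τ • v) - s x - B (τ • v)‖ * ‖v‖ := abs_real_inner_le_norm _ _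
      _ ≤ (η * ‖τ • v‖) * ‖v‖ := by gcongr
      _ ≤ (η * ‖v‖) * ‖v‖ := by gcongr
      _ = _ := by ring
  have hinc : ∀ a b : ℝ, f (x + b • v) - f (x + a • v) ≤ (b - a) * inner ℝ (s (x + b • v)) v ∧
      (b - a) * inner ℝ (s (x + a • v)) v ≤ f (x + b • v) - f (x + a • v) := by
    intro a b
    have i1 := h.1 (x + b • v) (x + a • v)
    have i2 := h.1 (x + a • v) (x + b • v)
    have e1 : x + a • v - (x + b • v) = (a - b) • v := by rw [sub_smul]; abel
    have e2 : x + b • v - (x + a • v) = (b - a) • v := by rw [sub_smul]; abel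
    rw [e1, inner_smul_right] at i1
    rw [e2, inner_smul_right] at i2
    constructor <;> linarith
  rw [abs_le]
  constructor
  · have := telescoping (K := 1 / 2 * inner ℝ (B v) v) (φ := fun τ => -(f (x + τ • v) - f x - τ * inner ℝ (s x) v
      - τ ^ 2 / 2 * inner ℝ (B v) v + η * ‖v‖ ^ 2 * τ)) (by
        intro a b ha hab hb
        have i1 := (hinc a b).2
        have i2 := (abs_le.1 (hsb a ha (hab.trans hb))).1
        have i3 := mul_le_mul_of_nonneg_left i2 (sub_nonneg.2 hab)
        nlinarith)
    simp at this
    linarith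
  · have := telescoping (K := 1 / 2 * inner ℝ (B v) v) (φ := fun τ => (f (x + τ • v) - f x - τ * inner ℝ (s x) v
      - τ ^ 2 / 2 * inner ℝ (B v) v - η * ‖v‖ ^ 2 * τ)) (by
        intro a b ha hab hb
        have i1 := (hinc a b).1
        have i2 := (abs_le.1 (hsb b (ha.trans hab) hb)).2
        have i3 := mul_le_mul_of_nonneg_left i2 (sub_nonneg.2 hab)
        nlinarith)
    simp at this
    linarith

variable [MeasurableSpace E] [BorelSpace E]

/-- Alexandrov's theorem in the form: subgradients of a convex function are differentiable a.e. -/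
theorem IsSubgrad.ae_differentiableAt {f : E → ℝ} {s : E → E} {R : ℝ} (h : IsSubgrad f s R) :
    ∀ᵐ x ∂(μH[finrank ℝ E] : Measure E), DifferentiableAt ℝ s x := by
  set μ : Measure E := μH[finrank ℝ E] with hμ
  have hdist : ∀ x x' : E, ‖x - x'‖ ≤ ‖(x + s x) - (x' + s x')‖ := by
    intro x x'
    have h1 := h.mono x' x
    have h2 : ‖(x + s x) - (x' + s x')‖ ^ 2 = ‖x - x'‖ ^ 2 + 2 * inner ℝ (s x - s x') (x - x')
        + ‖s x - s x'‖ ^ 2 := by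
      have : (x + s x) - (x' + s x') = (x - x') + (s x - s x') := by abel
      rw [this, norm_add_sq_real, real_inner_comm]
    have h3 : ‖x - x'‖ ^ 2 ≤ ‖(x + s x) - (x' + s x')‖ ^ 2 := by
      rw [h2]; nlinarith [sq_nonneg ‖s x - s x'‖]
    exact le_of_sq_le_sq h3 (norm_nonneg _)
  set G : E → E := fun x => x + s x with hG
  have hinj : Function.Injective G := by
    intro x x' hx
    have := hdist x x'
    have h0 : x + s x - (x' + s x') = 0 := sub_eq_zero.2 hx
    rw [h0, norm_zero] at this
    exact sub_eq_zero.1 (norm_le_zero_iff.1 this)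
  set J : E → E := Function.invFun G with hJ
  have hJG : ∀ x, J (G x) = x := Function.leftInverse_invFun hinj
  have hJl : LipschitzOnWith 1 J (range G) := by
    apply LipschitzOnWith.of_dist_le_mul
    rintro _ ⟨x, rfl⟩ _ ⟨x', rfl⟩
    rw [hJG, hJG, dist_eq_norm, dist_eq_norm]
    simpa using hdist x x'
  have hR := hJl.ae_differentiableWithinAt_of_mem (μ := μ)
  set N1 : Set E := {y | y ∈ range G ∧ ¬ DifferentiableWithinAt ℝ J (range G) y} with hN1
  have hN1z : μ N1 = 0 := by
    rw [ae_iff] at hR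
    convert hR using 2
    ext y; simp [hN1]
  have hN1J : μ (J '' N1) = 0 := by
    have := (hJl.mono (show N1 ⊆ range G from fun y hy => hy.1)).hausdorffMeasure_image_le
      (d := finrank ℝ E) (by positivity)
    rw [← hμ, hN1z] at this
    simpa using this
  set N2 : Set E := {y | y ∈ range G ∧ DifferentiableWithinAt ℝ J (range G) y ∧
    (fderivWithin ℝ J (range G) y).det = 0} with hN2
  have hN2J : μ (J '' N2) = 0 := by
    apply addHaar_image_eq_zero_of_det_fderivWithin_eq_zero (f' := fderivWithin ℝ J (range G))
    · intro y hy
      exact hy.2.1.hasFDerivWithinAt.mono (fun y hy => hy.1)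
    · intro y hy; exact hy.2.2
  have hfd := h.lipschitz.ae_differentiableAt (μ := μ)
  have a1 : ∀ᵐ x ∂μ, x ∉ J '' N1 := measure_eq_zero_iff_ae_notMem.1 hN1J
  have a2 : ∀ᵐ x ∂μ, x ∉ J '' N2 := measure_eq_zero_iff_ae_notMem.1 hN2J
  filter_upwards [hfd, a1, a2] with x hx hx1 hx2
  have b1 : DifferentiableWithinAt ℝ J (range G) (G x) := by
    by_contra hc
    exact hx1 ⟨G x, ⟨mem_range_self x, hc⟩, hJG x⟩
  have b2 : (fderivWithin ℝ J (range G) (G x)).det ≠ 0 := by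
    intro hc
    exact hx2 ⟨G x, ⟨mem_range_self x, b1, hc⟩, hJG x⟩
  have hc : ContinuousAt G x := continuousAt_id.add (h.continuousAt hx)
  have b3 := b1.hasFDerivWithinAt
  rw [← ContinuousLinearMap.coe_toContinuousLinearEquivOfDetNeZero _ b2] at b3
  have b4 := HasFDerivWithinAt.of_local_left_inverse (g := G) (s := univ) (a := x)
    (by
      rw [nhdsWithin_univ]
      exact tendsto_nhdsWithin_iff.2 ⟨hc, Eventually.of_forall fun y => mem_range_self y⟩) b3
      (mem_univ _) (Eventually.of_forall hJG)
  have b5 : DifferentiableAt ℝ G x := by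
    simpa [differentiableWithinAt_univ] using b4.differentiableWithinAt
  have b6 : s = fun y => G y - y := by ext y; simp [hG]
  rw [b6]
  exact b5.sub differentiableAt_id

/-- Jensen's lemma combined with Alexandrov's theorem. -/
theorem jensen {f₁ f₂ : E → ℝ} {s₁ s₂ : E → E} {R : ℝ} (h₁ : IsSubgrad f₁ s₁ R)
    (h₂ : IsSubgrad f₂ s₂ R) {r : ℝ} (hr : 0 < r) :
    ∃ p ξ : E, ‖p‖ < r ∧ (∀ ζ, f₁ ζ + f₂ ζ - ‖ζ‖ ^ 2 - inner ℝ p ζ ≤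
      f₁ ξ + f₂ ξ - ‖ξ‖ ^ 2 - inner ℝ p ξ) ∧ s₁ ξ + s₂ ξ = (2 : ℝ) • ξ + p ∧
      DifferentiableAt ℝ s₁ ξ ∧ DifferentiableAt ℝ s₂ ξ := by
  have hex : ∀ p : E, ∃ ξ : E, ∀ ζ, f₁ ζ + f₂ ζ - ‖ζ‖ ^ 2 - inner ℝ p ζ ≤
      f₁ ξ + f₂ ξ - ‖ξ‖ ^ 2 - inner ℝ p ξ := by
    intro p
    have hc : Continuous fun ζ => f₁ ζ + f₂ ζ - ‖ζ‖ ^ 2 - inner ℝ p ζ := by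
      have := h₁.lipschitz.continuous
      have := h₂.lipschitz.continuous
      fun_prop
    apply hc.exists_forall_ge' 0
    have hR : 0 ≤ R := (norm_nonneg _).trans (h₁.2 0)
    have : ∀ᶠ ζ : E in cocompact E, 2 * R + ‖p‖ ≤ ‖ζ‖ :=
      (tendsto_norm_cocompact_atTop (E := E)).eventually_ge_atTop _
    filter_upwards [this] with ζ hζ
    have a1 := h₁.1 ζ 0
    have a2 := h₂.1 ζ 0
    simp only [zero_sub, inner_neg_right] at a1 a2
    have b1 := (abs_le.1 (abs_real_inner_le_norm (s₁ ζ) ζ)).2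
    have b2 := (abs_le.1 (abs_real_inner_le_norm (s₂ ζ) ζ)).2
    have b3 := (abs_le.1 (abs_real_inner_le_norm p ζ)).1
    have c1 := mul_le_mul_of_nonneg_right (h₁.2 ζ) (norm_nonneg ζ)
    have c2 := mul_le_mul_of_nonneg_right (h₂.2 ζ) (norm_nonneg ζ)
    have c3 := mul_le_mul_of_nonneg_right hζ (norm_nonneg ζ)
    simp only [norm_zero, inner_zero_right]
    nlinarith
  choose ξ hξ using hex
  have hs : ∀ p, s₁ (ξ p) + s₂ (ξ p) = (2 : ℝ) • ξ p + p := by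
    intro p
    by_contra hne
    set w := s₁ (ξ p) + s₂ (ξ p) - ((2 : ℝ) • ξ p + p) with hw
    have hw0 : w ≠ 0 := sub_ne_zero.2 hne
    have hwn : 0 < ‖w‖ := norm_pos_iff.2 hw0
    have a1 := h₁.1 (ξ p) (ξ p + (1 / 2 : ℝ) • w)
    have a2 := h₂.1 (ξ p) (ξ p + (1 / 2 : ℝ) • w)
    have a3 := hξ p (ξ p + (1 / 2 : ℝ) • w)
    rw [norm_add_sq_real, norm_smul, inner_add_right] at a3
    simp only [add_sub_cancel_left, inner_smul_right] at a1 a2 a3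
    have e : ‖w‖ ^ 2 = inner ℝ (s₁ (ξ p)) w + inner ℝ (s₂ (ξ p)) w - 2 * inner ℝ (ξ p) w
        - inner ℝ p w := by
      rw [← real_inner_self_eq_norm_sq]
      nth_rewrite 1 [hw]
      rw [inner_sub_left, inner_add_left, inner_add_left, real_inner_smul_left]
      ring
    norm_num at a3
    nlinarith
  have hlip : ∀ p q, ‖q - p‖ ≤ 6 * ‖ξ q - ξ p‖ := by
    intro p q
    have hup : ∀ v, f₁ (ξ p + v) + f₂ (ξ p + v) ≤ f₁ (ξ p) + f₂ (ξ p)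
        + inner ℝ (s₁ (ξ p) + s₂ (ξ p)) v + ‖v‖ ^ 2 := by
      intro v
      have a3 := hξ p (ξ p + v)
      rw [norm_add_sq_real, inner_add_right] at a3
      rw [hs, inner_add_left, real_inner_smul_left]
      linarith
    have hS : ‖(s₁ (ξ q) + s₂ (ξ q)) - (s₁ (ξ p) + s₂ (ξ p))‖ ≤ 4 * ‖ξ q - ξ p‖ := by
      set S := (s₁ (ξ q) + s₂ (ξ q)) - (s₁ (ξ p) + s₂ (ξ p)) with hSdef
      by_cases h0 : S = 0
      · rw [h0, norm_zero]; positivity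
      have hn : 0 < ‖S‖ := norm_pos_iff.2 h0
      by_cases hτ : ξ q = ξ p
      · exfalso; apply h0; rw [hSdef, hτ, sub_self]
      have hτ : 0 < ‖ξ q - ξ p‖ := norm_pos_iff.2 (sub_ne_zero.2 hτ)
      set v : E := (‖ξ q - ξ p‖ / ‖S‖) • S with hv
      have hvn : ‖v‖ = ‖ξ q - ξ p‖ := by
        rw [hv, norm_smul, Real.norm_of_nonneg (by positivity)]
        field_simp
      have hSv : inner ℝ S v = ‖ξ q - ξ p‖ * ‖S‖ := by
        rw [hv, inner_smul_right, real_inner_self_eq_norm_sq]; field_simp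
      have a1 := h₁.1 (ξ q) (ξ q + v)
      have a2 := h₂.1 (ξ q) (ξ q + v)
      have a3 := h₁.1 (ξ p) (ξ q)
      have a4 := h₂.1 (ξ p) (ξ q)
      have a5 := hup ((ξ q - ξ p) + v)
      have e1 : ξ p + ((ξ q - ξ p) + v) = ξ q + v := by abel
      rw [e1] at a5
      rw [add_sub_cancel_left] at a1 a2
      have hn2 : ‖(ξ q - ξ p) + v‖ ≤ 2 * ‖ξ q - ξ p‖ := by
        have := norm_add_le (ξ q - ξ p) v
        rw [hvn] at this
        linarith
      have hn3 : ‖(ξ q - ξ p) + v‖ ^ 2 ≤ (2 * ‖ξ q - ξ p‖) ^ 2 := by gcongr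
      rw [inner_add_left, inner_add_right, inner_add_right] at a5
      rw [hSdef, inner_sub_left, inner_add_left, inner_add_left] at hSv
      have : ‖ξ q - ξ p‖ * ‖S‖ ≤ ‖ξ q - ξ p‖ * (4 * ‖ξ q - ξ p‖) := by nlinarith
      exact le_of_mul_le_mul_left this hτ
    rw [hs, hs] at hS
    have e : q - p = ((2 : ℝ) • ξ q + q - ((2 : ℝ) • ξ p + p)) - (2 : ℝ) • (ξ q - ξ p) := by
      rw [smul_sub]; abel
    calc ‖q - p‖ = ‖((2 : ℝ) • ξ q + q - ((2 : ℝ) • ξ p + p)) - (2 : ℝ) • (ξ q - ξ p)‖ := by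
          rw [← e]
      _ ≤ _ := norm_sub_le _ _
      _ ≤ 4 * ‖ξ q - ξ p‖ + 2 * ‖ξ q - ξ p‖ := by
          rw [norm_smul]
          gcongr
          norm_num
      _ = _ := by ring
  by_contra hcon
  push Not at hcon
  set μ : Measure E := μH[finrank ℝ E] with hμ
  have hinj : Function.Injective ξ := by
    intro p q hpq
    have := hlip p q
    rw [hpq, sub_self, norm_zero, mul_zero] at this
    exact (sub_eq_zero.1 (norm_le_zero_iff.1 this)).symm
  set K : Set E := ξ '' Metric.ball 0 r with hK
  have hKz : μ K = 0 := by
    have a1 := h₁.ae_differentiableAt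
    have a2 := h₂.ae_differentiableAt
    have a3 := a1.and a2
    rw [ae_iff] at a3
    refine measure_mono_null ?_ a3
    rintro _ ⟨p, hp, rfl⟩ ⟨hd1, hd2⟩
    exact hcon p (ξ p) (by simpa using hp) (hξ p) (hs p) hd1 hd2
  set P : E → E := Function.invFun ξ with hP
  have hPξ : ∀ p, P (ξ p) = p := Function.leftInverse_invFun hinj
  have hPl : LipschitzOnWith 6 P K := by
    apply LipschitzOnWith.of_dist_le_mul
    rintro _ ⟨p, hp, rfl⟩ _ ⟨q, hq, rfl⟩
    rw [hPξ, hPξ, dist_eq_norm, dist_eq_norm]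
    exact hlip q p
  have h1 := hPl.hausdorffMeasure_image_le (d := finrank ℝ E) (by positivity)
  rw [← hμ, hKz, mul_zero] at h1
  have h2 : P '' K = Metric.ball 0 r := by
    rw [hK, image_image]
    simp [hPξ]
  rw [h2] at h1
  have h3 : 0 < μ (Metric.ball (0 : E) r) := Metric.measure_ball_pos μ 0 hr
  exact absurd h1 (not_le.2 h3)

end Convex

section Sums

set_option linter.unusedSectionVars false

open MeasureTheory Filter Topology Module

variable {E : Type*} [NormedAddCommGroup E] [InnerProductSpace ℝ E] [FiniteDimensional ℝ E]
variable {V : Type*} [NormedAddCommGroup V] [NormedSpace ℝ V]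

lemma conj_exists {D : Set V} (hD : IsCompact D) (hne : D.Nonempty) {a : V → ℝ}
    (ha : ContinuousOn a D) (L : V →L[ℝ] E) :
    ∃ (f : E → ℝ) (z : E → V) (R : ℝ), (∀ R', R ≤ R' → IsSubgrad f (fun ξ => L (z ξ)) R') ∧
      (∀ ξ, z ξ ∈ D) ∧
      (∀ ξ, f ξ = a (z ξ) - (1 / 2) * ‖L (z ξ)‖ ^ 2 + inner ℝ (L (z ξ)) ξ) ∧
      ∀ y ∈ D, ∀ ξ, a y - (1 / 2) * ‖L y‖ ^ 2 + inner ℝ (L y) ξ ≤ f ξ := by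
  have hex : ∀ ξ : E, ∃ z ∈ D, ∀ y ∈ D, a y - (1 / 2) * ‖L y‖ ^ 2 + inner ℝ (L y) ξ ≤
      a z - (1 / 2) * ‖L z‖ ^ 2 + inner ℝ (L z) ξ := by
    intro ξ
    have hc : ContinuousOn (fun y => a y - (1 / 2) * ‖L y‖ ^ 2 + inner ℝ (L y) ξ) D := by
      have : Continuous fun y => (1 / 2) * ‖L y‖ ^ 2 := by fun_prop
      have h2 : Continuous fun y => inner ℝ (L y) ξ := by fun_prop
      exact (ha.sub this.continuousOn).add h2.continuousOn
    obtain ⟨z, hz, hm⟩ := hD.exists_isMaxOn hne hc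
    exact ⟨z, hz, fun y hy => hm hy⟩
  choose z hz hm using hex
  obtain ⟨R, hR⟩ := (hD.image L.continuous).isBounded.exists_norm_le
  refine ⟨fun ξ => a (z ξ) - (1 / 2) * ‖L (z ξ)‖ ^ 2 + inner ℝ (L (z ξ)) ξ, z, R, ?_, hz,
    fun ξ => rfl, fun y hy ξ => hm ξ y hy⟩
  intro R' hRR
  constructor
  · intro x y
    have := hm y (z x) (hz x)
    simp only [inner_sub_right]
    linarith
  · intro x
    exact (hR _ (mem_image_of_mem L (hz x))).trans hRR

lemma quad_nonpos {q : E → ℝ} (hq : ∀ (τ : ℝ) v, q (τ • v) = τ ^ 2 * q v)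
    (h : ∀ η > 0, ∀ᶠ v in 𝓝 (0 : E), q v ≤ η * ‖v‖ ^ 2) (v : E) : q v ≤ 0 := by
  have key : ∀ η > 0, q v ≤ η * ‖v‖ ^ 2 := by
    intro η hη
    have h1 := h η hη
    have ht : Tendsto (fun τ : ℝ => τ • v) (𝓝[>] 0) (𝓝 (0 : E)) := by
      have : Tendsto (fun τ : ℝ => τ • v) (𝓝 0) (𝓝 ((0 : ℝ) • v)) := by
        apply Continuous.tendsto; fun_prop
      rw [zero_smul] at this
      exact this.mono_left nhdsWithin_le_nhds
    obtain ⟨τ, h2, h3⟩ := ((ht.eventually h1).and self_mem_nhdsWithin).exists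
    have h3 : (0 : ℝ) < τ := h3
    rw [hq, norm_smul, mul_pow, Real.norm_of_nonneg h3.le] at h2
    have : τ ^ 2 * q v ≤ τ ^ 2 * (η * ‖v‖ ^ 2) := by linarith
    exact le_of_mul_le_mul_left this (by positivity)
  by_contra hc
  push Not at hc
  have h1 := key (q v / (2 * (‖v‖ ^ 2 + 1))) (by positivity)
  have h2 : q v / (2 * (‖v‖ ^ 2 + 1)) * ‖v‖ ^ 2 ≤ q v / 2 := by
    rw [div_mul_eq_mul_div, div_le_div_iff₀ (by positivity) (by positivity)]
    nlinarith [sq_nonneg ‖v‖]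
  linarith

lemma quad_smul (B : E →L[ℝ] E) (τ : ℝ) (v : E) :
    inner ℝ (B (τ • v)) (τ • v) = τ ^ 2 * inner ℝ (B v) v := by
  rw [map_smul, real_inner_smul_left, inner_smul_right]; ring

lemma upper_test {D : Set V} {a : V → ℝ} {L : V →L[ℝ] E} {f : E → ℝ} {z : E → V} {R : ℝ}
    (hs : IsSubgrad f (fun ξ => L (z ξ)) R)
    (hf : ∀ ξ, f ξ = a (z ξ) - (1 / 2) * ‖L (z ξ)‖ ^ 2 + inner ℝ (L (z ξ)) ξ)
    (hm : ∀ y ∈ D, ∀ ξ, a y - (1 / 2) * ‖L y‖ ^ 2 + inner ℝ (L y) ξ ≤ f ξ)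
    {ξ : E} {B : E →L[ℝ] E} (hB : HasFDerivAt (fun ξ => L (z ξ)) B ξ) {η : ℝ} (hη : 0 < η) :
    ∃ S : E →L[ℝ] E,
      (∀ᶠ y in 𝓝[D] (z ξ), a y ≤ a (z ξ) + inner ℝ (L (z ξ) - ξ) (L (y - z ξ))
        + (1 / 2) * inner ℝ (S (L (y - z ξ))) (L (y - z ξ))) ∧
      ∀ H κ, inner ℝ (S H) H ≤ ‖H‖ ^ 2 - 2 * inner ℝ H κ + inner ℝ (B κ) κ + 2 * η * ‖κ‖ ^ 2 := by
  have hpos : ∀ v, 0 ≤ inner ℝ (B v) v := by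
    intro v
    have := quad_nonpos (q := fun v => - ((1 / 2 : ℝ) * inner ℝ (B v) v))
      (by intro τ v; simp only [quad_smul]; ring) (by
        intro η' hη'
        filter_upwards [hs.expansion hB hη'] with v hv
        have h1 := hs.1 ξ (ξ + v)
        rw [add_sub_cancel_left] at h1
        have := (abs_le.1 hv).2
        linarith) v
    linarith
  set M : E →L[ℝ] E := (1 / 2 : ℝ) • (B + ContinuousLinearMap.adjoint B)
    + (2 * η) • ContinuousLinearMap.id ℝ E with hM
  have hMq : ∀ v, inner ℝ (M v) v = inner ℝ (B v) v + 2 * η * ‖v‖ ^ 2 := by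
    intro v
    simp only [hM, _root_.add_apply, _root_.smul_apply,
      ContinuousLinearMap.id_apply, inner_add_left, real_inner_smul_left,
      ContinuousLinearMap.adjoint_inner_left, real_inner_self_eq_norm_sq]
    rw [real_inner_comm (B v) v]
    ring
  have hMs : ∀ v w, inner ℝ (M v) w = inner ℝ v (M w) := by
    intro v w
    simp only [hM, _root_.add_apply, _root_.smul_apply,
      ContinuousLinearMap.id_apply, inner_add_left, real_inner_smul_left,
      ContinuousLinearMap.adjoint_inner_left, inner_add_right, inner_smul_right,
      ContinuousLinearMap.adjoint_inner_right]
    ring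
  have hinj : Function.Injective (M : E →ₗ[ℝ] E) := by
    rw [← LinearMap.ker_eq_bot, LinearMap.ker_eq_bot']
    intro v hv
    have h1 := hMq v
    have hv' : M v = 0 := hv
    rw [hv', inner_zero_left] at h1
    have h2 := hpos v
    have h3 : ‖v‖ ^ 2 ≤ 0 := by
      by_contra hc
      push Not at hc
      have := mul_pos hη hc
      linarith
    have h4 : ‖v‖ = 0 := by nlinarith [norm_nonneg v]
    exact norm_eq_zero.1 h4
  set e := (LinearEquiv.ofInjectiveEndo (M : E →ₗ[ℝ] E) hinj).toContinuousLinearEquiv with he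
  set K : E →L[ℝ] E := (e.symm : E →L[ℝ] E) with hK
  have hMK : ∀ v, M (K v) = v := by
    intro v
    have := e.apply_symm_apply v
    exact this
  refine ⟨ContinuousLinearMap.id ℝ E - K, ?_, ?_⟩
  · have h1 := hs.expansion hB hη
    have ht : Tendsto (fun y => K (L (y - z ξ))) (𝓝[D] (z ξ)) (𝓝 0) := by
      have : Tendsto (fun y => K (L (y - z ξ))) (𝓝 (z ξ)) (𝓝 (K (L (z ξ - z ξ)))) := by
        apply Continuous.tendsto; fun_prop
      rw [sub_self, map_zero, map_zero] at this
      exact this.mono_left nhdsWithin_le_nhds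
    filter_upwards [ht.eventually h1, self_mem_nhdsWithin] with y hy hyD
    set H := L (y - z ξ) with hH
    have hLy : L y = L (z ξ) + H := by rw [hH, map_sub]; abel
    have h2 := (abs_le.1 hy).2
    have h3 := hm y hyD (ξ + K H)
    have h4 := hf ξ
    have h5 := hMq (K H)
    rw [hMK] at h5
    rw [hLy, norm_add_sq_real] at h3
    simp only [inner_add_left, inner_add_right] at h3
    simp only [_root_.sub_apply, ContinuousLinearMap.id_apply, inner_sub_left,
      real_inner_self_eq_norm_sq]
    rw [real_inner_comm H (K H), real_inner_comm H ξ]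
    linarith
  · intro H κ
    have h1 := hpos (K H - κ)
    have h2 := hMq (K H - κ)
    have h3 := hMq κ
    have h4 := hMs κ (K H)
    have h6 : 0 ≤ inner ℝ (M (K H - κ)) (K H - κ) := by
      rw [h2]; positivity
    rw [map_sub, hMK, inner_sub_left, inner_sub_right, inner_sub_right] at h6
    rw [hMK] at h4
    simp only [_root_.sub_apply, ContinuousLinearMap.id_apply, inner_sub_left,
      real_inner_self_eq_norm_sq]
    rw [real_inner_comm H (K H)]
    rw [real_inner_comm H κ] at h4
    linarith

/-- A version of the theorem on sums. -/
theorem sums {D : Set V} (hD : IsCompact D) (hne : D.Nonempty) {a b : V → ℝ}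
    (ha : ContinuousOn a D) (hb : ContinuousOn b D) (L : V →L[ℝ] E) {η r : ℝ}
    (hη : 0 < η) (hr : 0 < r) :
    ∃ (p : E) (z z' : V) (S S' : E →L[ℝ] E), ‖p‖ < r ∧ z ∈ D ∧ z' ∈ D ∧
      (∀ y ∈ D, ∀ y' ∈ D,
        a y + b y' - (1 / 4) * ‖L y - L y'‖ ^ 2 - (1 / 2) * inner ℝ p (L y + L y') ≤
        a z + b z' - (1 / 4) * ‖L z - L z'‖ ^ 2 - (1 / 2) * inner ℝ p (L z + L z')) ∧
      (∀ᶠ y in 𝓝[D] z, a y ≤ a z + (1 / 2) * inner ℝ (L z - L z' + p) (L (y - z))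
        + (1 / 2) * inner ℝ (S (L (y - z))) (L (y - z))) ∧
      (∀ᶠ y in 𝓝[D] z', b y ≤ b z' + (1 / 2) * inner ℝ (L z' - L z + p) (L (y - z'))
        + (1 / 2) * inner ℝ (S' (L (y - z'))) (L (y - z'))) ∧
      ∀ H H', inner ℝ (S H) H + inner ℝ (S' H') H' ≤ (1 / 2) * ‖H - H'‖ ^ 2
        + η * (‖H‖ ^ 2 + ‖H'‖ ^ 2) := by
  let _ : MeasurableSpace E := borel E
  have _ : BorelSpace E := ⟨rfl⟩
  obtain ⟨f₁, z₁, R₁, hs₁, hz₁, hf₁, hm₁⟩ := conj_exists hD hne ha L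
  obtain ⟨f₂, z₂, R₂, hs₂, hz₂, hf₂, hm₂⟩ := conj_exists hD hne hb L
  replace hs₁ := hs₁ _ (le_max_left R₁ R₂)
  replace hs₂ := hs₂ _ (le_max_right R₁ R₂)
  obtain ⟨p, ξ, hp, hmax, hsum, ⟨B₁, hB₁⟩, ⟨B₂, hB₂⟩⟩ := jensen hs₁ hs₂ hr
  obtain ⟨S, hS, hSq⟩ := upper_test hs₁ hf₁ hm₁ hB₁ (show 0 < η / 2 by positivity)
  obtain ⟨S', hS', hSq'⟩ := upper_test hs₂ hf₂ hm₂ hB₂ (show 0 < η / 2 by positivity)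
  have hξ2 : (2 : ℝ) • ξ = L (z₁ ξ) + L (z₂ ξ) - p := by rw [hsum]; abel
  have hξ : ξ = (1 / 2 : ℝ) • (L (z₁ ξ) + L (z₂ ξ) - p) := by
    rw [← hξ2, smul_smul]; norm_num
  have hB : ∀ κ, inner ℝ (B₁ κ) κ + inner ℝ (B₂ κ) κ ≤ 2 * ‖κ‖ ^ 2 := by
    intro κ
    have := quad_nonpos (q := fun v => (1 / 2 : ℝ) * inner ℝ (B₁ v) v
        + (1 / 2 : ℝ) * inner ℝ (B₂ v) v - ‖v‖ ^ 2)
      (by intro τ v; simp only [quad_smul, norm_smul, mul_pow, Real.norm_eq_abs, sq_abs]; ring) (by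
        intro η' hη'
        filter_upwards [hs₁.expansion hB₁ (show 0 < η' / 2 by positivity),
          hs₂.expansion hB₂ (show 0 < η' / 2 by positivity)] with v hv1 hv2
        have h1 := hmax (ξ + v)
        rw [norm_add_sq_real, inner_add_right] at h1
        have h2 := (abs_le.1 hv1).1
        have h3 := (abs_le.1 hv2).1
        have h4 : inner ℝ (L (z₁ ξ)) v + inner ℝ (L (z₂ ξ)) v = 2 * inner ℝ ξ v + inner ℝ p v := by
          rw [← inner_add_left, hsum, inner_add_left, real_inner_smul_left]
        linarith) κ
    linarith
  refine ⟨p, z₁ ξ, z₂ ξ, S, S', hp, hz₁ ξ, hz₂ ξ, ?_, ?_, ?_, ?_⟩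
  · have hval : ∀ A B : E, - (1 / 2) * ‖A‖ ^ 2 - (1 / 2) * ‖B‖ ^ 2
        + inner ℝ A ((1 / 2 : ℝ) • (A + B - p)) + inner ℝ B ((1 / 2 : ℝ) • (A + B - p))
        - ‖(1 / 2 : ℝ) • (A + B - p)‖ ^ 2 - inner ℝ p ((1 / 2 : ℝ) • (A + B - p))
        = - (1 / 4) * ‖A - B‖ ^ 2 - (1 / 2) * inner ℝ p (A + B) + (1 / 4) * ‖p‖ ^ 2 := by
      intro A B
      simp only [← real_inner_self_eq_norm_sq, inner_smul_right, real_inner_smul_left,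
        inner_add_left, inner_add_right, inner_sub_left, inner_sub_right]
      rw [real_inner_comm A B, real_inner_comm p A, real_inner_comm p B]
      ring
    intro y hy y' hy'
    have h1 := hmax ((1 / 2 : ℝ) • (L y + L y' - p))
    have h2 := hm₁ y hy ((1 / 2 : ℝ) • (L y + L y' - p))
    have h3 := hm₂ y' hy' ((1 / 2 : ℝ) • (L y + L y' - p))
    have h4 := hval (L y) (L y')
    have h5 := hval (L (z₁ ξ)) (L (z₂ ξ))
    rw [← hξ] at h5
    have h6 := hf₁ ξ
    have h7 := hf₂ ξ
    linarith
  · have e : L (z₁ ξ) - ξ = (1 / 2 : ℝ) • (L (z₁ ξ) - L (z₂ ξ) + p) := by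
      nth_rewrite 2 [hξ]
      module
    rw [e] at hS
    simpa only [real_inner_smul_left] using hS
  · have e : L (z₂ ξ) - ξ = (1 / 2 : ℝ) • (L (z₂ ξ) - L (z₁ ξ) + p) := by
      nth_rewrite 2 [hξ]
      module
    rw [e] at hS'
    simpa only [real_inner_smul_left] using hS'
  · intro H H'
    have h1 := hSq H ((1 / 2 : ℝ) • (H + H'))
    have h2 := hSq' H' ((1 / 2 : ℝ) • (H + H'))
    have h3 := hB ((1 / 2 : ℝ) • (H + H'))
    have h4 : ‖(1 / 2 : ℝ) • (H + H')‖ ^ 2 = (1 / 4) * (‖H‖ ^ 2 + 2 * inner ℝ H H' + ‖H'‖ ^ 2) := by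
      rw [norm_smul, mul_pow, norm_add_sq_real]; norm_num
    have h5 : inner ℝ H ((1 / 2 : ℝ) • (H + H')) = (1 / 2) * (‖H‖ ^ 2 + inner ℝ H H') := by
      rw [inner_smul_right, inner_add_right, real_inner_self_eq_norm_sq]
    have h6 : inner ℝ H' ((1 / 2 : ℝ) • (H + H')) = (1 / 2) * (‖H'‖ ^ 2 + inner ℝ H H') := by
      rw [inner_smul_right, inner_add_right, real_inner_self_eq_norm_sq, real_inner_comm H H']
      ring
    have h7 := norm_sub_sq_real H H'
    have h8 : 2 * inner ℝ H H' ≤ ‖H‖ ^ 2 + ‖H'‖ ^ 2 := by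
      nlinarith [sq_nonneg ‖H - H'‖]
    rw [h4] at h1 h2 h3
    rw [h5] at h1
    rw [h6] at h2
    nlinarith

end Sums

section Calc

open Filter Topology

variable {k d : ℕ}

/-- column `r` of the matrix `σ(t,x)` -/
def col (σ : ℝ → EuclideanSpace ℝ (Fin k) → Fin k → Fin d → ℝ) (r : Fin d)
    (z : ℝ × EuclideanSpace ℝ (Fin k)) : EuclideanSpace ℝ (Fin k) :=
  WithLp.toLp 2 (fun p => σ z.1 z.2 p r)

lemma fderiv_apply_fderiv {V : Type*} [NormedAddCommGroup V] [NormedSpace ℝ V] {φ : V → ℝ}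
    (hφ : ContDiff ℝ 2 φ) (z v h : V) :
    fderiv ℝ (fun y => fderiv ℝ φ y v) z h = fderiv ℝ (fderiv ℝ φ) z h v := by
  have hd : DifferentiableAt ℝ (fderiv ℝ φ) z :=
    (hφ.fderiv_right (m := 1) (by norm_num)).differentiable (by norm_num) z
  have := hd.hasFDerivAt.clm_apply (hasFDerivAt_const v z)
  rw [this.fderiv]
  simp

lemma col_sum (σ : ℝ → EuclideanSpace ℝ (Fin k) → Fin k → Fin d → ℝ) (r : Fin d)
    (z : ℝ × EuclideanSpace ℝ (Fin k)) :
    ((0 : ℝ), col σ r z) = ∑ p : Fin k, σ z.1 z.2 p r •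
      ((0 : ℝ), (EuclideanSpace.single p 1 : EuclideanSpace ℝ (Fin k))) := by
  have h := (EuclideanSpace.basisFun (Fin k) ℝ).sum_repr (col σ r z)
  simp only [EuclideanSpace.basisFun_repr, EuclideanSpace.basisFun_apply] at h
  apply Prod.ext
  · simp [Prod.fst_sum]
  · rw [Prod.snd_sum]
    simp only [Prod.smul_snd]
    exact h.symm

lemma opA_eq (σ : ℝ → EuclideanSpace ℝ (Fin k) → Fin k → Fin d → ℝ)
    (b : ℝ → EuclideanSpace ℝ (Fin k) → EuclideanSpace ℝ (Fin k))
    {φ : ℝ × EuclideanSpace ℝ (Fin k) → ℝ} (hφ : ContDiff ℝ 2 φ)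
    (t : ℝ) (x : EuclideanSpace ℝ (Fin k)) :
    opA σ b φ t x = (1 / 2) * ∑ r : Fin d, fderiv ℝ (fderiv ℝ φ) (t, x)
      (0, col σ r (t, x)) (0, col σ r (t, x)) + fderiv ℝ φ (t, x) (0, b t x) := by
  unfold opA
  congr 2
  simp only [fderiv_apply_fderiv hφ, col_sum]
  simp only [map_sum, map_smul, ContinuousLinearMap.coe_sum', Finset.sum_apply,
    _root_.smul_apply, smul_eq_mul, Finset.sum_mul, Finset.mul_sum]
  rw [Finset.sum_comm]
  conv_rhs => rw [Finset.sum_comm]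
  refine Finset.sum_congr rfl fun q _ => ?_
  rw [Finset.sum_comm]
  refine Finset.sum_congr rfl fun r _ => ?_
  refine Finset.sum_congr rfl fun p _ => ?_
  ring

/-- the parabolic operator -/
def parab (σ : ℝ → EuclideanSpace ℝ (Fin k) → Fin k → Fin d → ℝ)
    (b : ℝ → EuclideanSpace ℝ (Fin k) → EuclideanSpace ℝ (Fin k))
    (φ : ℝ × EuclideanSpace ℝ (Fin k) → ℝ) (z : ℝ × EuclideanSpace ℝ (Fin k)) : ℝ :=
  dt φ z.1 z.2 + opA σ b φ z.1 z.2

lemma parab_eq (σ : ℝ → EuclideanSpace ℝ (Fin k) → Fin k → Fin d → ℝ)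
    (b : ℝ → EuclideanSpace ℝ (Fin k) → EuclideanSpace ℝ (Fin k))
    {φ : ℝ × EuclideanSpace ℝ (Fin k) → ℝ} (hφ : ContDiff ℝ 2 φ)
    (z : ℝ × EuclideanSpace ℝ (Fin k)) :
    parab σ b φ z = fderiv ℝ φ z (1, 0) + ((1 / 2) * ∑ r : Fin d, fderiv ℝ (fderiv ℝ φ) z
      (0, col σ r z) (0, col σ r z) + fderiv ℝ φ z (0, b z.1 z.2)) := by
  unfold parab dt
  rw [opA_eq σ b hφ]

lemma fderiv_fderiv_add {V : Type*} [NormedAddCommGroup V] [NormedSpace ℝ V] {φ χ : V → ℝ}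
    (hφ : ContDiff ℝ 2 φ) (hχ : ContDiff ℝ 2 χ) (z : V) :
    fderiv ℝ (fun y => φ y + χ y) z = fderiv ℝ φ z + fderiv ℝ χ z ∧
    fderiv ℝ (fderiv ℝ (fun y => φ y + χ y)) z
      = fderiv ℝ (fderiv ℝ φ) z + fderiv ℝ (fderiv ℝ χ) z := by
  have h1 : ∀ z, fderiv ℝ (fun y => φ y + χ y) z = fderiv ℝ φ z + fderiv ℝ χ z := fun z =>
    fderiv_fun_add (hφ.differentiable (by norm_num) z) (hχ.differentiable (by norm_num) z)
  refine ⟨h1 z, ?_⟩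
  have : fderiv ℝ (fun y => φ y + χ y) = fun z => fderiv ℝ φ z + fderiv ℝ χ z := funext h1
  rw [this]
  exact fderiv_fun_add
    ((hφ.fderiv_right (m := 1) (by norm_num)).differentiable (by norm_num) z)
    ((hχ.fderiv_right (m := 1) (by norm_num)).differentiable (by norm_num) z)

lemma parab_add (σ : ℝ → EuclideanSpace ℝ (Fin k) → Fin k → Fin d → ℝ)
    (b : ℝ → EuclideanSpace ℝ (Fin k) → EuclideanSpace ℝ (Fin k))
    {φ χ : ℝ × EuclideanSpace ℝ (Fin k) → ℝ} (hφ : ContDiff ℝ 2 φ) (hχ : ContDiff ℝ 2 χ)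
    (z : ℝ × EuclideanSpace ℝ (Fin k)) :
    parab σ b (fun y => φ y + χ y) z = parab σ b φ z + parab σ b χ z := by
  rw [parab_eq σ b hφ, parab_eq σ b hχ, parab_eq σ b (hφ.add hχ),
    (fderiv_fderiv_add hφ hχ z).1, (fderiv_fderiv_add hφ hχ z).2]
  simp only [_root_.add_apply, Finset.sum_add_distrib]
  ring

lemma parab_smul (σ : ℝ → EuclideanSpace ℝ (Fin k) → Fin k → Fin d → ℝ)
    (b : ℝ → EuclideanSpace ℝ (Fin k) → EuclideanSpace ℝ (Fin k))
    {φ : ℝ × EuclideanSpace ℝ (Fin k) → ℝ} (hφ : ContDiff ℝ 2 φ) (c : ℝ)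
    (z : ℝ × EuclideanSpace ℝ (Fin k)) :
    parab σ b (fun y => c * φ y) z = c * parab σ b φ z := by
  have h1 : ∀ z, fderiv ℝ (fun y => c * φ y) z = c • fderiv ℝ φ z := fun z =>
    fderiv_const_mul (hφ.differentiable (by norm_num) z) c
  have h2 : fderiv ℝ (fun y => c * φ y) = fun z => c • fderiv ℝ φ z := funext h1
  have h3 : fderiv ℝ (fderiv ℝ (fun y => c * φ y)) z = c • fderiv ℝ (fderiv ℝ φ) z := by
    rw [h2]
    exact fderiv_fun_const_smul
      ((hφ.fderiv_right (m := 1) (by norm_num)).differentiable (by norm_num) z) c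
  rw [parab_eq σ b hφ, parab_eq σ b (contDiff_const.mul hφ), h1, h3]
  simp only [_root_.smul_apply, smul_eq_mul, ← Finset.mul_sum]
  ring

lemma quad_deriv {V : Type*} [NormedAddCommGroup V] [NormedSpace ℝ V] (c : ℝ) (ℓ : V →L[ℝ] ℝ)
    (B : V →L[ℝ] V →L[ℝ] ℝ) (z : V) :
    ContDiff ℝ 2 (fun y => c + ℓ (y - z) + (1 / 2) * B (y - z) (y - z)) ∧
    fderiv ℝ (fun y => c + ℓ (y - z) + (1 / 2) * B (y - z) (y - z)) z = ℓ ∧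
    ∀ h, fderiv ℝ (fderiv ℝ (fun y => c + ℓ (y - z) + (1 / 2) * B (y - z) (y - z))) z h h
      = B h h := by
  have h1 : ∀ y, HasFDerivAt (fun y => c + ℓ (y - z) + (1 / 2) * B (y - z) (y - z))
      (ℓ + (1 / 2 : ℝ) • ((B + B.flip) (y - z))) y := by
    intro y
    have hs : HasFDerivAt (fun y => y - z) (ContinuousLinearMap.id ℝ V) y :=
      (hasFDerivAt_id y).sub_const z
    have hl : HasFDerivAt (fun y => ℓ (y - z)) (ℓ.comp (ContinuousLinearMap.id ℝ V)) y :=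
      ℓ.hasFDerivAt.comp y hs
    have hB : HasFDerivAt (fun y => B (y - z)) (B.comp (ContinuousLinearMap.id ℝ V)) y :=
      B.hasFDerivAt.comp y hs
    have := (hl.const_add c).add ((hB.clm_apply hs).const_mul (1 / 2))
    refine this.congr_fderiv ?_
    ext v
    simp
  have h2 : fderiv ℝ (fun y => c + ℓ (y - z) + (1 / 2) * B (y - z) (y - z))
      = fun y => ℓ + (1 / 2 : ℝ) • ((B + B.flip) (y - z)) := funext fun y => (h1 y).fderiv
  refine ⟨?_, ?_, ?_⟩
  · have a1 : ContDiff ℝ 2 (fun y => y - z) := contDiff_id.sub contDiff_const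
    have a2 : ContDiff ℝ 2 (fun y => ℓ (y - z)) := ℓ.contDiff.comp a1
    have a3 : ContDiff ℝ 2 (fun y => B (y - z)) := B.contDiff.comp a1
    exact (contDiff_const.add a2).add (contDiff_const.mul (a3.clm_apply a1))
  · rw [h2]; simp
  · intro h
    rw [h2]
    have hs : HasFDerivAt (fun y => y - z) (ContinuousLinearMap.id ℝ V) z :=
      (hasFDerivAt_id z).sub_const z
    have hB : HasFDerivAt (fun y => (B + B.flip) (y - z))
        ((B + B.flip).comp (ContinuousLinearMap.id ℝ V)) z :=
      (B + B.flip).hasFDerivAt.comp z hs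
    have : HasFDerivAt (fun y => ℓ + (1 / 2 : ℝ) • (B + B.flip) (y - z))
        ((1 / 2 : ℝ) • ((B + B.flip).comp (ContinuousLinearMap.id ℝ V))) z :=
      (hB.const_smul (1 / 2 : ℝ)).const_add ℓ
    rw [this.fderiv]
    simp
    ring

lemma parab_quad (σ : ℝ → EuclideanSpace ℝ (Fin k) → Fin k → Fin d → ℝ)
    (b : ℝ → EuclideanSpace ℝ (Fin k) → EuclideanSpace ℝ (Fin k)) (c : ℝ)
    (ℓ : ℝ × EuclideanSpace ℝ (Fin k) →L[ℝ] ℝ)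
    (B : ℝ × EuclideanSpace ℝ (Fin k) →L[ℝ] ℝ × EuclideanSpace ℝ (Fin k) →L[ℝ] ℝ)
    (z : ℝ × EuclideanSpace ℝ (Fin k)) :
    parab σ b (fun y => c + ℓ (y - z) + (1 / 2) * B (y - z) (y - z)) z
      = ℓ (1, 0) + ((1 / 2) * ∑ r : Fin d, B (0, col σ r z) (0, col σ r z)
        + ℓ (0, b z.1 z.2)) := by
  obtain ⟨h1, h2, h3⟩ := quad_deriv c ℓ B z
  rw [parab_eq σ b h1, h2]
  simp only [h3]

lemma col_continuousOn {σ : ℝ → EuclideanSpace ℝ (Fin k) → Fin k → Fin d → ℝ}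
    {s : Set (ℝ × EuclideanSpace ℝ (Fin k))}
    (hσ : ∀ p r, ContinuousOn (fun q : ℝ × EuclideanSpace ℝ (Fin k) => σ q.1 q.2 p r) s)
    (r : Fin d) : ContinuousOn (col σ r) s := by
  unfold col
  have h : ContinuousOn (fun z : ℝ × EuclideanSpace ℝ (Fin k) => fun p => σ z.1 z.2 p r) s :=
    continuousOn_pi.2 fun p => hσ p r
  exact (PiLp.continuous_toLp 2 _).comp_continuousOn h

lemma parab_continuousOn {σ : ℝ → EuclideanSpace ℝ (Fin k) → Fin k → Fin d → ℝ}
    {b : ℝ → EuclideanSpace ℝ (Fin k) → EuclideanSpace ℝ (Fin k)}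
    {s : Set (ℝ × EuclideanSpace ℝ (Fin k))}
    (hσ : ∀ p r, ContinuousOn (fun q : ℝ × EuclideanSpace ℝ (Fin k) => σ q.1 q.2 p r) s)
    (hb : ContinuousOn (fun q : ℝ × EuclideanSpace ℝ (Fin k) => b q.1 q.2) s)
    {φ : ℝ × EuclideanSpace ℝ (Fin k) → ℝ} (hφ : ContDiff ℝ 2 φ) :
    ContinuousOn (parab σ b φ) s := by
  have h0 : parab σ b φ = _ := funext fun z => parab_eq σ b hφ z
  rw [h0]
  have c1 : Continuous (fderiv ℝ φ) := hφ.continuous_fderiv (by norm_num)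
  have c2 : Continuous (fderiv ℝ (fderiv ℝ φ)) :=
    (hφ.fderiv_right (m := 1) (by norm_num)).continuous_fderiv (by norm_num)
  refine (c1.clm_apply continuous_const).continuousOn.add (ContinuousOn.add ?_ ?_)
  · refine continuousOn_const.mul (continuousOn_finsetSum _ fun r _ => ?_)
    have hc : ContinuousOn (fun z => ((0 : ℝ), col σ r z)) s :=
      continuousOn_const.prodMk (col_continuousOn hσ r)
    exact (c2.continuousOn.clm_apply hc).clm_apply hc
  · exact c1.continuousOn.clm_apply (continuousOn_const.prodMk hb)

lemma col_sub_le {σ : ℝ → EuclideanSpace ℝ (Fin k) → Fin k → Fin d → ℝ} (r : Fin d)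
    (z z' : ℝ × EuclideanSpace ℝ (Fin k)) :
    ‖col σ r z - col σ r z'‖ ≤ ∑ p : Fin k, ∑ r : Fin d, |σ z.1 z.2 p r - σ z'.1 z'.2 p r| := by
  have h1 : ‖col σ r z - col σ r z'‖ ≤ ∑ p : Fin k, |σ z.1 z.2 p r - σ z'.1 z'.2 p r| := by
    have h := (EuclideanSpace.basisFun (Fin k) ℝ).sum_repr (col σ r z - col σ r z')
    rw [← h]
    refine (norm_sum_le _ _).trans (Finset.sum_le_sum fun p _ => ?_)
    rw [norm_smul]
    simp [col]
  refine h1.trans (Finset.sum_le_sum fun p _ => ?_)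
  exact Finset.single_le_sum (f := fun r => |σ z.1 z.2 p r - σ z'.1 z'.2 p r|)
    (fun r _ => abs_nonneg _) (Finset.mem_univ r)

lemma exists_Lam (k : ℕ) (α β : ℝ) :
    ∃ L : (ℝ × EuclideanSpace ℝ (Fin k)) →L[ℝ] WithLp 2 (ℝ × EuclideanSpace ℝ (Fin k)),
      ∀ v v', inner ℝ (L v) (L v') = α ^ 2 * (v.1 * v'.1) + β ^ 2 * inner ℝ v.2 v'.2 := by
  refine ⟨((WithLp.prodContinuousLinearEquiv 2 ℝ ℝ (EuclideanSpace ℝ (Fin k))).symm :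
    _ →L[ℝ] _).comp ((α • ContinuousLinearMap.fst ℝ ℝ (EuclideanSpace ℝ (Fin k))).prod
      (β • ContinuousLinearMap.snd ℝ ℝ (EuclideanSpace ℝ (Fin k)))), ?_⟩
  intro v v'
  rw [WithLp.prod_inner_apply]
  simp [inner_smul_right, real_inner_smul_left]
  ring

end Calc

section Core

open Filter Topology

variable {k d : ℕ}

lemma exists_bilin {V F : Type*} [NormedAddCommGroup V] [NormedSpace ℝ V]
    [NormedAddCommGroup F] [InnerProductSpace ℝ F] (L : V →L[ℝ] F) (S : F →L[ℝ] F) :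
    ∃ B : V →L[ℝ] V →L[ℝ] ℝ, ∀ h h', B h h' = inner ℝ (S (L h)) (L h') := by
  refine ⟨(isBoundedBilinearMap_inner (𝕜 := ℝ) (E := F)).toContinuousLinearMap.bilinearComp
    (S.comp L) L, ?_⟩
  intro h h'
  rfl

lemma exists_lin {V F : Type*} [NormedAddCommGroup V] [NormedSpace ℝ V]
    [NormedAddCommGroup F] [InnerProductSpace ℝ F] (L : V →L[ℝ] F) (q : F) (c : ℝ) :
    ∃ ℓ : V →L[ℝ] ℝ, ∀ h, ℓ h = c * inner ℝ q (L h) := by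
  refine ⟨c • (innerSL ℝ q).comp L, ?_⟩
  intro h
  simp

/-- the algebra of the two viscosity inequalities -/
lemma combine (σ : ℝ → EuclideanSpace ℝ (Fin k) → Fin k → Fin d → ℝ)
    (b : ℝ → EuclideanSpace ℝ (Fin k) → EuclideanSpace ℝ (Fin k))
    {Z : ℝ × EuclideanSpace ℝ (Fin k) → ℝ} (hZ : ContDiff ℝ 2 Z)
    {F : Type*} [NormedAddCommGroup F] [InnerProductSpace ℝ F]
    {Λ : (ℝ × EuclideanSpace ℝ (Fin k)) →L[ℝ] F} {α β η : ℝ}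
    (hΛ : ∀ v v', inner ℝ (Λ v) (Λ v') = α ^ 2 * (v.1 * v'.1) + β ^ 2 * inner ℝ v.2 v'.2)
    {p : F} {S S' : F →L[ℝ] F}
    (hS : ∀ H H', inner ℝ (S H) H + inner ℝ (S' H') H'
      ≤ (1/2)*‖H - H'‖^2 + η*(‖H‖^2 + ‖H'‖^2))
    (z z' : ℝ × EuclideanSpace ℝ (Fin k)) (cu cw ψ1 ψ2 : ℝ)
    {ℓ ℓ' : ℝ × EuclideanSpace ℝ (Fin k) →L[ℝ] ℝ}
    {B B' : ℝ × EuclideanSpace ℝ (Fin k) →L[ℝ] ℝ × EuclideanSpace ℝ (Fin k) →L[ℝ] ℝ}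
    (hℓ : ∀ h, ℓ h = (1/2) * inner ℝ (Λ z - Λ z' + p) (Λ h))
    (hℓ' : ∀ h, ℓ' h = (-1/2) * inner ℝ (Λ z' - Λ z + p) (Λ h))
    (hB : ∀ h h', B h h' = inner ℝ (S (Λ h)) (Λ h'))
    (hB' : ∀ h h', B' h h' = inner ℝ ((-S') (Λ h)) (Λ h'))
    (Hu : -parab σ b (fun y => Z y + (cu + ℓ (y - z) + (1 / 2) * B (y - z) (y - z))) z - ψ1 ≤ 0)
    (Hw : 0 ≤ -parab σ b (fun y => cw + ℓ' (y - z') + (1 / 2) * B' (y - z') (y - z')) z' - ψ2) :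
    -parab σ b Z z ≤ inner ℝ p (Λ (1, 0)) + (1/2) * β^2 * inner ℝ (z.2 - z'.2)
        (b z.1 z.2 - b z'.1 z'.2) + (1/2) * inner ℝ p (Λ (0, b z.1 z.2 + b z'.1 z'.2))
      + (1/2) * ∑ r : Fin d, ((1/2) * β^2 * ‖col σ r z - col σ r z'‖^2
          + η * β^2 * (‖col σ r z‖^2 + ‖col σ r z'‖^2)) + ψ1 - ψ2 := by
  rw [parab_add σ b hZ (quad_deriv cu ℓ B z).1, parab_quad] at Hu
  rw [parab_quad] at Hw
  have hn : ∀ v : EuclideanSpace ℝ (Fin k), ‖Λ (0, v)‖^2 = β^2 * ‖v‖^2 := by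
    intro v
    rw [← real_inner_self_eq_norm_sq, hΛ, ← real_inner_self_eq_norm_sq]
    simp
  have hsum : ∑ r : Fin d, B (0, col σ r z) (0, col σ r z)
      - ∑ r : Fin d, B' (0, col σ r z') (0, col σ r z') ≤
      ∑ r : Fin d, ((1/2) * β^2 * ‖col σ r z - col σ r z'‖^2
          + η * β^2 * (‖col σ r z‖^2 + ‖col σ r z'‖^2)) := by
    rw [← Finset.sum_sub_distrib]
    refine Finset.sum_le_sum fun r _ => ?_
    rw [hB, hB']
    have h := hS (Λ (0, col σ r z)) (Λ (0, col σ r z'))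
    rw [← map_sub, Prod.mk_sub_mk, sub_zero, hn, hn, hn] at h
    rw [_root_.neg_apply, inner_neg_left]
    linarith
  have e1 : ℓ (1, 0) - ℓ' (1, 0) = inner ℝ p (Λ (1, 0)) := by
    rw [hℓ, hℓ']
    simp only [inner_add_left, inner_sub_left]
    ring
  have e2 : ℓ (0, b z.1 z.2) - ℓ' (0, b z'.1 z'.2) = (1/2) * β^2 * inner ℝ (z.2 - z'.2)
        (b z.1 z.2 - b z'.1 z'.2) + (1/2) * inner ℝ p (Λ (0, b z.1 z.2 + b z'.1 z'.2)) := by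
    rw [hℓ, hℓ']
    have : ((0 : ℝ), b z.1 z.2 + b z'.1 z'.2) = (0, b z.1 z.2) + (0, b z'.1 z'.2) := by simp
    rw [this, map_add]
    simp only [inner_add_left, inner_sub_left, inner_add_right, inner_sub_right, hΛ]
    simp
    ring
  linarith

end Core

section Core2

open Filter Topology

variable {k d : ℕ}

/-- all coefficients packed into one map -/
def coef (σ : ℝ → EuclideanSpace ℝ (Fin k) → Fin k → Fin d → ℝ)
    (b : ℝ → EuclideanSpace ℝ (Fin k) → EuclideanSpace ℝ (Fin k))
    (z : ℝ × EuclideanSpace ℝ (Fin k)) :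
    (Fin d → EuclideanSpace ℝ (Fin k)) × EuclideanSpace ℝ (Fin k) :=
  (fun r => col σ r z, b z.1 z.2)

lemma coef_col {σ : ℝ → EuclideanSpace ℝ (Fin k) → Fin k → Fin d → ℝ}
    {b : ℝ → EuclideanSpace ℝ (Fin k) → EuclideanSpace ℝ (Fin k)} (r : Fin d)
    (z z' : ℝ × EuclideanSpace ℝ (Fin k)) :
    ‖col σ r z - col σ r z'‖ ≤ ‖coef σ b z - coef σ b z'‖ :=
  (norm_le_pi_norm (coef σ b z - coef σ b z').1 r).trans (norm_fst_le _)

lemma coef_b {σ : ℝ → EuclideanSpace ℝ (Fin k) → Fin k → Fin d → ℝ}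
    {b : ℝ → EuclideanSpace ℝ (Fin k) → EuclideanSpace ℝ (Fin k)}
    (z z' : ℝ × EuclideanSpace ℝ (Fin k)) :
    ‖b z.1 z.2 - b z'.1 z'.2‖ ≤ ‖coef σ b z - coef σ b z'‖ :=
  norm_snd_le (coef σ b z - coef σ b z')

lemma coef_col0 {σ : ℝ → EuclideanSpace ℝ (Fin k) → Fin k → Fin d → ℝ}
    {b : ℝ → EuclideanSpace ℝ (Fin k) → EuclideanSpace ℝ (Fin k)} (r : Fin d)
    (z : ℝ × EuclideanSpace ℝ (Fin k)) : ‖col σ r z‖ ≤ ‖coef σ b z‖ :=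
  (norm_le_pi_norm (coef σ b z).1 r).trans (norm_fst_le _)

lemma coef_b0 {σ : ℝ → EuclideanSpace ℝ (Fin k) → Fin k → Fin d → ℝ}
    {b : ℝ → EuclideanSpace ℝ (Fin k) → EuclideanSpace ℝ (Fin k)}
    (z : ℝ × EuclideanSpace ℝ (Fin k)) : ‖b z.1 z.2‖ ≤ ‖coef σ b z‖ :=
  norm_snd_le (coef σ b z)

lemma coef_lip {T C : ℝ} {σ : ℝ → EuclideanSpace ℝ (Fin k) → Fin k → Fin d → ℝ}
    {b : ℝ → EuclideanSpace ℝ (Fin k) → EuclideanSpace ℝ (Fin k)}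
    (hL : ∀ t ∈ Icc (0 : ℝ) T, ∀ x x' : EuclideanSpace ℝ (Fin k),
      (∑ p : Fin k, ∑ r : Fin d, |σ t x p r - σ t x' p r|) + ‖b t x - b t x'‖ ≤ C * ‖x - x'‖)
    {t : ℝ} (ht : t ∈ Icc (0 : ℝ) T) (x x' : EuclideanSpace ℝ (Fin k)) :
    ‖coef σ b (t, x) - coef σ b (t, x')‖ ≤ C * ‖x - x'‖ := by
  have h := hL t ht x x'
  have h0 : 0 ≤ ∑ p : Fin k, ∑ r : Fin d, |σ t x p r - σ t x' p r| :=
    Finset.sum_nonneg fun _ _ => Finset.sum_nonneg fun _ _ => abs_nonneg _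
  have h1 := norm_nonneg (b t x - b t x')
  refine norm_prod_le_iff.2 ⟨?_, ?_⟩
  · refine (pi_norm_le_iff_of_nonneg (by linarith)).2 fun r => ?_
    have := col_sub_le (σ := σ) r (t, x) (t, x')
    simp only at this
    show ‖col σ r (t, x) - col σ r (t, x')‖ ≤ _
    linarith
  · show ‖b t x - b t x'‖ ≤ _
    linarith

lemma coef_continuousOn {σ : ℝ → EuclideanSpace ℝ (Fin k) → Fin k → Fin d → ℝ}
    {b : ℝ → EuclideanSpace ℝ (Fin k) → EuclideanSpace ℝ (Fin k)}
    {s : Set (ℝ × EuclideanSpace ℝ (Fin k))}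
    (hσ : ∀ p r, ContinuousOn (fun q : ℝ × EuclideanSpace ℝ (Fin k) => σ q.1 q.2 p r) s)
    (hb : ContinuousOn (fun q : ℝ × EuclideanSpace ℝ (Fin k) => b q.1 q.2) s) :
    ContinuousOn (coef σ b) s :=
  (continuousOn_pi.2 fun r => col_continuousOn hσ r).prodMk hb

set_option maxHeartbeats 4000000 in
lemma step {T C ρ : ℝ} {σ : ℝ → EuclideanSpace ℝ (Fin k) → Fin k → Fin d → ℝ}
    {b : ℝ → EuclideanSpace ℝ (Fin k) → EuclideanSpace ℝ (Fin k)}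
    (hσ : ∀ p r, ContinuousOn (fun q : ℝ × EuclideanSpace ℝ (Fin k) => σ q.1 q.2 p r)
      (Icc 0 T ×ˢ univ))
    (hb : ContinuousOn (fun q : ℝ × EuclideanSpace ℝ (Fin k) => b q.1 q.2) (Icc 0 T ×ˢ univ))
    (hC : 0 ≤ C)
    (hL : ∀ t ∈ Icc (0 : ℝ) T, ∀ x x' : EuclideanSpace ℝ (Fin k),
      (∑ p : Fin k, ∑ r : Fin d, |σ t x p r - σ t x' p r|) + ‖b t x - b t x'‖ ≤ C * ‖x - x'‖)
    {u w ψ Z : ℝ × EuclideanSpace ℝ (Fin k) → ℝ}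
    (hu : ContinuousOn u (Icc 0 T ×ˢ univ)) (hw : ContinuousOn w (Icc 0 T ×ˢ univ))
    (hZ : ContDiff ℝ 2 Z) {z0 : ℝ × EuclideanSpace ℝ (Fin k)}
    (hz0 : z0 ∈ Icc (0:ℝ) T ×ˢ (univ : Set (EuclideanSpace ℝ (Fin k)))) (hρ : 0 < ρ)
    (Hu : ∀ z ∈ Icc (0:ℝ) T ×ˢ (univ : Set (EuclideanSpace ℝ (Fin k))), z ∈ Metric.ball z0 ρ →
      ∀ φ : ℝ × EuclideanSpace ℝ (Fin k) → ℝ, ContDiff ℝ 2 φ → φ z = u z →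
      IsLocalMinOn (fun y => φ y - u y) (Icc 0 T ×ˢ univ) z → -parab σ b φ z - ψ z ≤ 0)
    (Hw : ∀ z ∈ Icc (0:ℝ) T ×ˢ (univ : Set (EuclideanSpace ℝ (Fin k))), z ∈ Metric.ball z0 ρ →
      ∀ φ : ℝ × EuclideanSpace ℝ (Fin k) → ℝ, ContDiff ℝ 2 φ → φ z = w z →
      IsLocalMaxOn (fun y => φ y - w y) (Icc 0 T ×ˢ univ) z → 0 ≤ -parab σ b φ z - ψ z) :
    ∃ K : ℝ, 0 ≤ K ∧ ∀ ε : ℝ, 0 < ε → ε ≤ 1 → ∃ (z z' : ℝ × EuclideanSpace ℝ (Fin k)) (X : ℝ),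
      z ∈ (Icc (0:ℝ) T ×ˢ (univ : Set (EuclideanSpace ℝ (Fin k)))) ∩ Metric.closedBall z0 ρ ∧
      z' ∈ (Icc (0:ℝ) T ×ˢ (univ : Set (EuclideanSpace ℝ (Fin k)))) ∩ Metric.closedBall z0 ρ ∧
      0 ≤ X ∧ ‖z - z'‖ ≤ ε ∧
      X ≤ 4 * ((u z - Z z - w z') - (u z0 - Z z0 - w z0)) + K * ε ∧
      (z ∈ Metric.ball z0 ρ → z' ∈ Metric.ball z0 ρ →
        -parab σ b Z z ≤ K * (X + ε) + ψ z - ψ z') := by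
  set dom : Set (ℝ × EuclideanSpace ℝ (Fin k)) := Icc (0:ℝ) T ×ˢ univ with hdom
  set D := dom ∩ Metric.closedBall z0 ρ with hDdef
  have hD : IsCompact D :=
    (isCompact_closedBall z0 ρ).inter_left (isClosed_Icc.prod isClosed_univ)
  have hz0D : z0 ∈ D := ⟨hz0, Metric.mem_closedBall_self hρ.le⟩
  set a : ℝ × EuclideanSpace ℝ (Fin k) → ℝ := fun y => u y - Z y with ha_def
  set bb : ℝ × EuclideanSpace ℝ (Fin k) → ℝ := fun y => - w y with hbb_def
  have ha : ContinuousOn a D := (hu.mono inter_subset_left).sub hZ.continuous.continuousOn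
  have hbb : ContinuousOn bb D := (hw.mono inter_subset_left).neg
  have hG : ContinuousOn (coef σ b) D := (coef_continuousOn hσ hb).mono inter_subset_left
  obtain ⟨Ca, hCa⟩ := hD.exists_bound_of_continuousOn ha
  obtain ⟨Cb, hCb⟩ := hD.exists_bound_of_continuousOn hbb
  obtain ⟨C1, hC1⟩ := hD.exists_bound_of_continuousOn hG
  have hCa0 : 0 ≤ Ca := (norm_nonneg _).trans (hCa z0 hz0D)
  have hCb0 : 0 ≤ Cb := (norm_nonneg _).trans (hCb z0 hz0D)
  have hC10 : 0 ≤ C1 := (norm_nonneg _).trans (hC1 z0 hz0D)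
  have hunif := hD.uniformContinuousOn_of_continuous hG
  rw [Metric.uniformContinuousOn_iff] at hunif
  set K := 2 + C + C1 + d * (C^2 + 1 + C1^2) + 4 * ρ with hK
  have hd0 : (0:ℝ) ≤ d := Nat.cast_nonneg d
  refine ⟨K, by positivity, ?_⟩
  intro ε hε hε1
  set M := 8 * Ca + 8 * Cb + 4 * ρ + 1 with hM
  have hM1 : 1 ≤ M := by linarith
  set β := M / ε with hβ
  have hβ0 : 0 < β := by positivity
  obtain ⟨δ0, hδ0, hδ⟩ := hunif (1 / β^2) (by positivity)
  set δ := min (δ0 / 2) ε with hδdef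
  have hδpos : 0 < δ := lt_min (by linarith) hε
  set α := M / δ with hα
  have hα0 : 0 < α := by positivity
  obtain ⟨Λ, hΛ⟩ := exists_Lam k α β
  obtain ⟨p, z, z', S, S', hp, hz, hz', hmax, hua, hub, hS⟩ :=
    sums hD ⟨z0, hz0D⟩ ha hbb Λ (η := ε / β^2) (r := ε / (‖Λ‖ + 1)) (by positivity) (by positivity)
  have hpΛ : ∀ v, |inner ℝ p (Λ v)| ≤ ε * ‖v‖ := by
    intro v
    have h1 := abs_real_inner_le_norm p (Λ v)
    have h2 := Λ.le_opNorm v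
    have h3 : ‖p‖ * (‖Λ‖ + 1) ≤ ε := ((lt_div_iff₀ (by positivity)).1 hp).le
    have h4 : ‖p‖ * ‖Λ v‖ ≤ ‖p‖ * (‖Λ‖ * ‖v‖) := by gcongr
    have h5 : ‖p‖ * (‖Λ‖ * ‖v‖) ≤ (‖p‖ * (‖Λ‖ + 1)) * ‖v‖ := by
      have : 0 ≤ ‖p‖ * ‖v‖ := by positivity
      linarith
    have h6 : (‖p‖ * (‖Λ‖ + 1)) * ‖v‖ ≤ ε * ‖v‖ := by gcongr
    linarith
  set X := ‖Λ z - Λ z'‖^2 with hX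
  have hX0 : 0 ≤ X := by positivity
  have hXeq : X = α^2 * (z.1 - z'.1)^2 + β^2 * ‖z.2 - z'.2‖^2 := by
    rw [hX, ← map_sub, ← real_inner_self_eq_norm_sq, hΛ, ← real_inner_self_eq_norm_sq]
    simp only [Prod.fst_sub, Prod.snd_sub]
    ring
  have hXle : X ≤ 4 * ((u z - Z z - w z') - (u z0 - Z z0 - w z0)) + 4 * ρ * ε := by
    have h := hmax z0 hz0D z0 hz0D
    have e : inner ℝ p (Λ z + Λ z') = inner ℝ p (Λ z0 + Λ z0) + inner ℝ p (Λ (z - z0))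
        + inner ℝ p (Λ (z' - z0)) := by
      simp only [map_sub, inner_add_right, inner_sub_right]; ring
    rw [e] at h
    have h1 := hpΛ (z - z0)
    have h2 := hpΛ (z' - z0)
    have h3 : ‖z - z0‖ ≤ ρ := by have := hz.2; rwa [mem_closedBall_iff_norm] at this
    have h4 : ‖z' - z0‖ ≤ ρ := by have := hz'.2; rwa [mem_closedBall_iff_norm] at this
    have h5 := (abs_le.1 h1).1
    have h6 := (abs_le.1 h2).1
    have h7 : ε * ‖z - z0‖ ≤ ε * ρ := by gcongr
    have h8 : ε * ‖z' - z0‖ ≤ ε * ρ := by gcongr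
    simp only [sub_self, norm_zero, ha_def, hbb_def] at h
    linarith
  have hXM : X ≤ M^2 := by
    have h1 := abs_le.1 (hCa z hz)
    have h2 := abs_le.1 (hCa z0 hz0D)
    have h3 := abs_le.1 (hCb z' hz')
    have h4 := abs_le.1 (hCb z0 hz0D)
    simp only [ha_def, hbb_def] at h1 h2 h3 h4
    have h5 : 4 * ρ * ε ≤ 4 * ρ := by nlinarith
    have : X ≤ M := by linarith [h1.2, h2.1, h3.2, h4.1]
    exact this.trans (le_self_pow₀ hM1 (by norm_num))
  have hxε : ‖z.2 - z'.2‖ ≤ ε := by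
    have h1 : β^2 * ‖z.2 - z'.2‖^2 ≤ M^2 := by
      have : 0 ≤ α^2 * (z.1 - z'.1)^2 := by positivity
      linarith
    rw [← mul_pow] at h1
    have h2 := (le_abs_self _).trans (abs_le_of_sq_le_sq h1 (by linarith))
    rw [hβ] at h2
    rw [div_mul_eq_mul_div, div_le_iff₀ hε] at h2
    exact le_of_mul_le_mul_left h2 (by linarith)
  have htδ : |z.1 - z'.1| ≤ δ := by
    have h1 : α^2 * |z.1 - z'.1|^2 ≤ M^2 := by
      have : 0 ≤ β^2 * ‖z.2 - z'.2‖^2 := by positivity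
      rw [sq_abs]
      linarith
    rw [← mul_pow] at h1
    have h2 := (le_abs_self _).trans (abs_le_of_sq_le_sq h1 (by linarith))
    rw [hα] at h2
    rw [div_mul_eq_mul_div, div_le_iff₀ hδpos] at h2
    exact le_of_mul_le_mul_left h2 (by linarith)
  have hzz' : ‖z - z'‖ ≤ ε :=
    norm_prod_le_iff.2 ⟨htδ.trans (min_le_right _ _), hxε⟩
  refine ⟨z, z', X, hz, hz', hX0, hzz', hXle.trans ?_, ?_⟩
  · have : 4 * ρ ≤ K := by
      have : 0 ≤ 2 + C + C1 + d * (C^2 + 1 + C1^2) := by positivity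
      linarith
    have := mul_le_mul_of_nonneg_right this hε.le
    linarith
  intro hzb hzb'
  obtain ⟨ℓ, hℓ⟩ := exists_lin Λ (Λ z - Λ z' + p) (1/2)
  obtain ⟨ℓ', hℓ'⟩ := exists_lin Λ (Λ z' - Λ z + p) (-1/2)
  obtain ⟨B, hB⟩ := exists_bilin Λ S
  obtain ⟨B', hB'⟩ := exists_bilin Λ (-S')
  have hnh : ∀ y ∈ Metric.ball z0 ρ, 𝓝[D] y = 𝓝[dom] y := by
    intro y hy
    rw [hDdef]
    refine nhdsWithin_inter_of_mem' ?_
    exact mem_nhdsWithin_of_mem_nhds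
      (Filter.mem_of_superset (Metric.isOpen_ball.mem_nhds hy) Metric.ball_subset_closedBall)
  rw [hnh z hzb] at hua
  rw [hnh z' hzb'] at hub
  have Hu' := Hu z hz.1 hzb
    (fun y => Z y + ((u z - Z z) + ℓ (y - z) + (1 / 2) * B (y - z) (y - z)))
    (hZ.add (quad_deriv _ ℓ B z).1) (by simp) (by
      show ∀ᶠ y in 𝓝[dom] z, _
      filter_upwards [hua] with y hy
      simp only [ha_def] at hy
      simp only [hℓ, hB, sub_self, map_zero, inner_zero_right, mul_zero]
      linarith)
  have Hw' := Hw z' hz'.1 hzb'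
    (fun y => w z' + ℓ' (y - z') + (1 / 2) * B' (y - z') (y - z'))
    (quad_deriv _ ℓ' B' z').1 (by simp) (by
      show ∀ᶠ y in 𝓝[dom] z', _
      filter_upwards [hub] with y hy
      simp only [hbb_def] at hy
      simp only [hℓ', hB', _root_.neg_apply, inner_neg_left, sub_self, map_zero,
        inner_zero_right, mul_zero]
      linarith)
  have key := combine σ b hZ hΛ hS z z' _ _ _ _ hℓ hℓ' hB hB' Hu' Hw'
  have hmid : ‖coef σ b z - coef σ b z'‖ ≤ C * ‖z.2 - z'.2‖ + 1 / β^2 := by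
    have hmD : (z.1, z'.2) ∈ D := by
      refine ⟨⟨hz.1.1, mem_univ _⟩, ?_⟩
      rw [mem_closedBall_iff_norm]
      have h3 := hz.2
      have h4 := hz'.2
      rw [mem_closedBall_iff_norm] at h3 h4
      exact norm_prod_le_iff.2 ⟨(norm_fst_le (z - z0)).trans h3, (norm_snd_le (z' - z0)).trans h4⟩
    have h1 : ‖coef σ b z - coef σ b (z.1, z'.2)‖ ≤ C * ‖z.2 - z'.2‖ :=
      coef_lip hL hz.1.1 z.2 z'.2
    have h2 : dist (coef σ b (z.1, z'.2)) (coef σ b z') < 1 / β^2 := by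
      refine hδ _ hmD _ hz' ?_
      rw [dist_eq_norm]
      refine lt_of_le_of_lt ?_ (half_lt_self hδ0)
      refine norm_prod_le_iff.2 ⟨htδ.trans (min_le_left _ _), ?_⟩
      simp
      linarith
    rw [dist_eq_norm] at h2
    have := norm_sub_le_norm_sub_add_norm_sub (coef σ b z) (coef σ b (z.1, z'.2)) (coef σ b z')
    linarith
  have hβx : β^2 * ‖z.2 - z'.2‖^2 ≤ X := by
    have : 0 ≤ α^2 * (z.1 - z'.1)^2 := by positivity
    linarith
  have hβε : 1 / β^2 ≤ ε := by
    rw [hβ, div_pow, one_div_div, div_le_iff₀ (by positivity)]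
    have : 1 ≤ M^2 := one_le_pow₀ hM1
    have h2 : ε * ε ≤ ε * 1 := by gcongr
    have h3 : ε * 1 ≤ ε * M^2 := by gcongr
    rw [sq]
    exact h2.trans h3
  have t1 : inner ℝ p (Λ (1, 0)) ≤ ε := by
    have := (abs_le.1 (hpΛ (1, 0))).2
    have e : ‖((1:ℝ), (0 : EuclideanSpace ℝ (Fin k)))‖ = 1 := by simp [Prod.norm_def]
    rw [e] at this
    linarith
  have t2 : (1/2) * inner ℝ p (Λ (0, b z.1 z.2 + b z'.1 z'.2)) ≤ C1 * ε := by
    have := (abs_le.1 (hpΛ (0, b z.1 z.2 + b z'.1 z'.2))).2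
    have e : ‖((0:ℝ), b z.1 z.2 + b z'.1 z'.2)‖ ≤ 2 * C1 := by
      refine norm_prod_le_iff.2 ⟨by simp; linarith, ?_⟩
      refine (norm_add_le _ _).trans ?_
      have h1 := (coef_b0 (σ := σ) (b := b) z).trans (hC1 z hz)
      have h2 := (coef_b0 (σ := σ) (b := b) z').trans (hC1 z' hz')
      linarith
    have : ε * ‖((0:ℝ), b z.1 z.2 + b z'.1 z'.2)‖ ≤ ε * (2 * C1) := by gcongr
    linarith
  have t3 : (1/2) * β^2 * inner ℝ (z.2 - z'.2) (b z.1 z.2 - b z'.1 z'.2) ≤ (C * X + ε) := by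
    have h1 := real_inner_le_norm (z.2 - z'.2) (b z.1 z.2 - b z'.1 z'.2)
    have h2 := (coef_b (σ := σ) (b := b) z z').trans hmid
    have h3 : ‖z.2 - z'.2‖ * ‖b z.1 z.2 - b z'.1 z'.2‖
        ≤ ‖z.2 - z'.2‖ * (C * ‖z.2 - z'.2‖ + 1 / β^2) := by gcongr
    have h4 : (1/2) * β^2 * inner ℝ (z.2 - z'.2) (b z.1 z.2 - b z'.1 z'.2)
        ≤ (1/2) * β^2 * (‖z.2 - z'.2‖ * (C * ‖z.2 - z'.2‖ + 1 / β^2)) := by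
      gcongr
      exact h1.trans h3
    have h5 : (1/2) * β^2 * (‖z.2 - z'.2‖ * (C * ‖z.2 - z'.2‖ + 1 / β^2))
        = (1/2) * (C * (β^2 * ‖z.2 - z'.2‖^2) + ‖z.2 - z'.2‖) := by
      field_simp
    have h6 : C * (β^2 * ‖z.2 - z'.2‖^2) ≤ C * X := by gcongr
    have h7 : 0 ≤ C * X := by positivity
    rw [h5] at h4
    linarith
  have t4 : (1/2) * ∑ r : Fin d, ((1/2) * β^2 * ‖col σ r z - col σ r z'‖^2
          + ε / β^2 * β^2 * (‖col σ r z‖^2 + ‖col σ r z'‖^2))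
      ≤ d * (C^2 * X + ε + C1^2 * ε) := by
    have hr : ∀ r : Fin d, (1/2) * β^2 * ‖col σ r z - col σ r z'‖^2
          + ε / β^2 * β^2 * (‖col σ r z‖^2 + ‖col σ r z'‖^2)
          ≤ 2 * (C^2 * X + ε + C1^2 * ε) := by
      intro r
      have h1 := (coef_col (σ := σ) (b := b) r z z').trans hmid
      have h2 := (coef_col0 (σ := σ) (b := b) r z).trans (hC1 z hz)
      have h3 := (coef_col0 (σ := σ) (b := b) r z').trans (hC1 z' hz')
      have h4 : ‖col σ r z‖^2 ≤ C1^2 := by gcongr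
      have h5 : ‖col σ r z'‖^2 ≤ C1^2 := by gcongr
      have h6 : ‖col σ r z - col σ r z'‖^2 ≤ (C * ‖z.2 - z'.2‖ + 1 / β^2)^2 := by gcongr
      have h7 : (C * ‖z.2 - z'.2‖ + 1 / β^2)^2 ≤ 2 * (C^2 * ‖z.2 - z'.2‖^2 + (1 / β^2)^2) := by
        nlinarith [sq_nonneg (C * ‖z.2 - z'.2‖ - 1 / β^2)]
      have h8 : (1/2) * β^2 * ‖col σ r z - col σ r z'‖^2
          ≤ (1/2) * β^2 * (2 * (C^2 * ‖z.2 - z'.2‖^2 + (1 / β^2)^2)) := by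
        gcongr
        exact h6.trans h7
      have h9 : (1/2) * β^2 * (2 * (C^2 * ‖z.2 - z'.2‖^2 + (1 / β^2)^2))
          = C^2 * (β^2 * ‖z.2 - z'.2‖^2) + 1 / β^2 := by
        field_simp
      have h10 : C^2 * (β^2 * ‖z.2 - z'.2‖^2) ≤ C^2 * X := by gcongr
      have h11 : ε / β^2 * β^2 = ε := by field_simp
      have h12 : ε * (‖col σ r z‖^2 + ‖col σ r z'‖^2) ≤ ε * (C1^2 + C1^2) := by gcongr
      have h13 : 0 ≤ C^2 * X := by positivity
      rw [h11]
      linarith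
    have := Finset.sum_le_sum (s := Finset.univ) fun r _ => hr r
    simp only [Finset.sum_const, Finset.card_univ, Fintype.card_fin, nsmul_eq_mul] at this
    linarith
  have hfin : ε + (C * X + ε) + C1 * ε + d * (C^2 * X + ε + C1^2 * ε) ≤ K * (X + ε) := by
    rw [hK]
    have q1 : 0 ≤ (2 + C1 + d * (1 + C1^2) + 4 * ρ) * X := by positivity
    have q2 : 0 ≤ (C + d * C^2 + 4 * ρ) * ε := by positivity
    linarith
  linarith

end Core2

section Core3

open Filter Topology

variable {k d : ℕ}

lemma strict_core {T C ρ : ℝ} {σ : ℝ → EuclideanSpace ℝ (Fin k) → Fin k → Fin d → ℝ}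
    {b : ℝ → EuclideanSpace ℝ (Fin k) → EuclideanSpace ℝ (Fin k)}
    (hσ : ∀ p r, ContinuousOn (fun q : ℝ × EuclideanSpace ℝ (Fin k) => σ q.1 q.2 p r)
      (Icc 0 T ×ˢ univ))
    (hb : ContinuousOn (fun q : ℝ × EuclideanSpace ℝ (Fin k) => b q.1 q.2) (Icc 0 T ×ˢ univ))
    (hC : 0 ≤ C)
    (hL : ∀ t ∈ Icc (0 : ℝ) T, ∀ x x' : EuclideanSpace ℝ (Fin k),
      (∑ p : Fin k, ∑ r : Fin d, |σ t x p r - σ t x' p r|) + ‖b t x - b t x'‖ ≤ C * ‖x - x'‖)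
    {u w ψ Z : ℝ × EuclideanSpace ℝ (Fin k) → ℝ}
    (hu : ContinuousOn u (Icc 0 T ×ˢ univ)) (hw : ContinuousOn w (Icc 0 T ×ˢ univ))
    (hψ : ContinuousOn ψ (Icc 0 T ×ˢ univ))
    (hZ : ContDiff ℝ 2 Z) {z0 : ℝ × EuclideanSpace ℝ (Fin k)}
    (hz0 : z0 ∈ Icc (0:ℝ) T ×ˢ (univ : Set (EuclideanSpace ℝ (Fin k)))) (hρ : 0 < ρ)
    (Hu : ∀ z ∈ Icc (0:ℝ) T ×ˢ (univ : Set (EuclideanSpace ℝ (Fin k))), z ∈ Metric.ball z0 ρ →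
      ∀ φ : ℝ × EuclideanSpace ℝ (Fin k) → ℝ, ContDiff ℝ 2 φ → φ z = u z →
      IsLocalMinOn (fun y => φ y - u y) (Icc 0 T ×ˢ univ) z → -parab σ b φ z - ψ z ≤ 0)
    (Hw : ∀ z ∈ Icc (0:ℝ) T ×ˢ (univ : Set (EuclideanSpace ℝ (Fin k))), z ∈ Metric.ball z0 ρ →
      ∀ φ : ℝ × EuclideanSpace ℝ (Fin k) → ℝ, ContDiff ℝ 2 φ → φ z = w z →
      IsLocalMaxOn (fun y => φ y - w y) (Icc 0 T ×ˢ univ) z → 0 ≤ -parab σ b φ z - ψ z)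
    (hmax : ∀ y ∈ Icc (0:ℝ) T ×ˢ (univ : Set (EuclideanSpace ℝ (Fin k))), y ≠ z0 →
      u y - Z y - w y < u z0 - Z z0 - w z0) :
    0 ≤ parab σ b Z z0 := by
  obtain ⟨K, hK, hstep⟩ := step hσ hb hC hL hu hw hZ hz0 hρ Hu Hw
  set dom : Set (ℝ × EuclideanSpace ℝ (Fin k)) := Icc (0:ℝ) T ×ˢ univ with hdom
  have hD : IsCompact (dom ∩ Metric.closedBall z0 ρ) :=
    (isCompact_closedBall z0 ρ).inter_left (isClosed_Icc.prod isClosed_univ)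
  have hε : ∀ n : ℕ, (0:ℝ) < 1 / ((n:ℝ) + 1) := fun n => by positivity
  have hε1 : ∀ n : ℕ, (1:ℝ) / ((n:ℝ) + 1) ≤ 1 := fun n => by
    rw [div_le_one (by positivity)]
    have : (0:ℝ) ≤ n := Nat.cast_nonneg n
    linarith
  choose z z' X hz hz' hX hzz hXle hin using fun n : ℕ => hstep _ (hε n) (hε1 n)
  obtain ⟨zs, hzs, f, hf, hlim⟩ := hD.tendsto_subseq hz
  have hε0 : Tendsto (fun n : ℕ => (1:ℝ) / ((f n : ℕ) + 1)) atTop (𝓝 0) :=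
    tendsto_one_div_add_atTop_nhds_zero_nat.comp hf.tendsto_atTop
  have hdiff : Tendsto (fun n => z (f n) - z' (f n)) atTop (𝓝 0) :=
    squeeze_zero_norm (fun n => hzz (f n)) hε0
  have hlim' : Tendsto (fun n => z' (f n)) atTop (𝓝 zs) := by
    have := Tendsto.sub hlim hdiff
    simpa using this
  have hw1 : Tendsto (fun n => z (f n)) atTop (𝓝[dom] zs) :=
    tendsto_nhdsWithin_iff.2 ⟨hlim, Eventually.of_forall fun n => (hz (f n)).1⟩
  have hw2 : Tendsto (fun n => z' (f n)) atTop (𝓝[dom] zs) :=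
    tendsto_nhdsWithin_iff.2 ⟨hlim', Eventually.of_forall fun n => (hz' (f n)).1⟩
  have l1 : Tendsto (fun n => u (z (f n))) atTop (𝓝 (u zs)) := (hu zs hzs.1).tendsto.comp hw1
  have l2 : Tendsto (fun n => w (z' (f n))) atTop (𝓝 (w zs)) := (hw zs hzs.1).tendsto.comp hw2
  have l3 : Tendsto (fun n => Z (z (f n))) atTop (𝓝 (Z zs)) :=
    (hZ.continuous.tendsto zs).comp hlim
  have l4 : Tendsto (fun n => 4 * ((u (z (f n)) - Z (z (f n)) - w (z' (f n)))
      - (u z0 - Z z0 - w z0)) + K * (1 / ((f n : ℕ) + 1))) atTop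
      (𝓝 (4 * ((u zs - Z zs - w zs) - (u z0 - Z z0 - w z0)) + K * 0)) :=
    ((((l1.sub l3).sub l2).sub tendsto_const_nhds).const_mul 4).add (hε0.const_mul K)
  have hge : 0 ≤ 4 * ((u zs - Z zs - w zs) - (u z0 - Z z0 - w z0)) + K * 0 :=
    ge_of_tendsto' l4 fun n => (hX (f n)).trans (hXle (f n))
  have heq : zs = z0 := by
    by_contra hne
    have := hmax zs hzs.1 hne
    linarith
  subst heq
  have hX0 : Tendsto (fun n => X (f n)) atTop (𝓝 0) := by
    refine squeeze_zero (fun n => hX (f n)) (fun n => hXle (f n)) ?_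
    simpa using l4
  have m1 : Tendsto (fun n => parab σ b Z (z (f n))) atTop (𝓝 (parab σ b Z zs)) :=
    (parab_continuousOn hσ hb hZ zs hzs.1).tendsto.comp hw1
  have m2 : Tendsto (fun n => ψ (z (f n))) atTop (𝓝 (ψ zs)) := (hψ zs hzs.1).tendsto.comp hw1
  have m3 : Tendsto (fun n => ψ (z' (f n))) atTop (𝓝 (ψ zs)) := (hψ zs hzs.1).tendsto.comp hw2
  have m4 : Tendsto (fun n => K * (X (f n) + 1 / ((f n : ℕ) + 1)) + ψ (z (f n)) - ψ (z' (f n)))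
      atTop (𝓝 (K * (0 + 0) + ψ zs - ψ zs)) :=
    (((hX0.add hε0).const_mul K).add m2).sub m3
  have hball := Metric.ball_mem_nhds zs hρ
  have := le_of_tendsto_of_tendsto m1.neg m4 (by
    filter_upwards [hlim.eventually hball, hlim'.eventually hball] with n h1 h2
    exact hin (f n) h1 h2)
  linarith

lemma core {T C ρ : ℝ} {σ : ℝ → EuclideanSpace ℝ (Fin k) → Fin k → Fin d → ℝ}
    {b : ℝ → EuclideanSpace ℝ (Fin k) → EuclideanSpace ℝ (Fin k)}
    (hσ : ∀ p r, ContinuousOn (fun q : ℝ × EuclideanSpace ℝ (Fin k) => σ q.1 q.2 p r)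
      (Icc 0 T ×ˢ univ))
    (hb : ContinuousOn (fun q : ℝ × EuclideanSpace ℝ (Fin k) => b q.1 q.2) (Icc 0 T ×ˢ univ))
    (hC : 0 ≤ C)
    (hL : ∀ t ∈ Icc (0 : ℝ) T, ∀ x x' : EuclideanSpace ℝ (Fin k),
      (∑ p : Fin k, ∑ r : Fin d, |σ t x p r - σ t x' p r|) + ‖b t x - b t x'‖ ≤ C * ‖x - x'‖)
    {u w ψ Z : ℝ × EuclideanSpace ℝ (Fin k) → ℝ}
    (hu : ContinuousOn u (Icc 0 T ×ˢ univ)) (hw : ContinuousOn w (Icc 0 T ×ˢ univ))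
    (hψ : ContinuousOn ψ (Icc 0 T ×ˢ univ))
    (hZ : ContDiff ℝ 2 Z) {z0 : ℝ × EuclideanSpace ℝ (Fin k)}
    (hz0 : z0 ∈ Icc (0:ℝ) T ×ˢ (univ : Set (EuclideanSpace ℝ (Fin k)))) (hρ : 0 < ρ)
    (Hu : ∀ z ∈ Icc (0:ℝ) T ×ˢ (univ : Set (EuclideanSpace ℝ (Fin k))), z ∈ Metric.ball z0 ρ →
      ∀ φ : ℝ × EuclideanSpace ℝ (Fin k) → ℝ, ContDiff ℝ 2 φ → φ z = u z →
      IsLocalMinOn (fun y => φ y - u y) (Icc 0 T ×ˢ univ) z → -parab σ b φ z - ψ z ≤ 0)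
    (Hw : ∀ z ∈ Icc (0:ℝ) T ×ˢ (univ : Set (EuclideanSpace ℝ (Fin k))), z ∈ Metric.ball z0 ρ →
      ∀ φ : ℝ × EuclideanSpace ℝ (Fin k) → ℝ, ContDiff ℝ 2 φ → φ z = w z →
      IsLocalMaxOn (fun y => φ y - w y) (Icc 0 T ×ˢ univ) z → 0 ≤ -parab σ b φ z - ψ z)
    (hmax : ∀ y ∈ Icc (0:ℝ) T ×ˢ (univ : Set (EuclideanSpace ℝ (Fin k))),
      u y - Z y - w y ≤ u z0 - Z z0 - w z0) :
    0 ≤ parab σ b Z z0 := by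
  obtain ⟨Λ, hΛ⟩ := exists_Lam k 1 1
  obtain ⟨B, hB⟩ := exists_bilin Λ (ContinuousLinearMap.id ℝ _)
  set Q : ℝ × EuclideanSpace ℝ (Fin k) → ℝ :=
    fun y => 0 + (0 : ℝ × EuclideanSpace ℝ (Fin k) →L[ℝ] ℝ) (y - z0)
      + (1/2) * B (y - z0) (y - z0) with hQ
  have hQc : ContDiff ℝ 2 Q := (quad_deriv 0 0 B z0).1
  have hQ0 : Q z0 = 0 := by simp [hQ]
  have hQpos : ∀ y, y ≠ z0 → 0 < Q y := by
    intro y hy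
    have e : Q y = (1/2) * ((y.1 - z0.1)^2 + ‖y.2 - z0.2‖^2) := by
      simp only [hQ, hB, ContinuousLinearMap.id_apply, hΛ]
      simp [sq]
    rw [e]
    by_contra hle
    have h1 : (y.1 - z0.1)^2 = 0 := by nlinarith [sq_nonneg (y.1 - z0.1), sq_nonneg ‖y.2 - z0.2‖]
    have h2 : ‖y.2 - z0.2‖^2 = 0 := by nlinarith [sq_nonneg (y.1 - z0.1), sq_nonneg ‖y.2 - z0.2‖]
    apply hy
    refine Prod.ext ?_ ?_
    · exact sub_eq_zero.1 (pow_eq_zero_iff two_ne_zero |>.1 h1)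
    · exact sub_eq_zero.1 (norm_eq_zero.1 (pow_eq_zero_iff two_ne_zero |>.1 h2))
  have hκ : ∀ κ : ℝ, 0 < κ → 0 ≤ parab σ b Z z0 + κ * parab σ b Q z0 := by
    intro κ hκ
    have hc : ContDiff ℝ 2 (fun y => κ * Q y) := contDiff_const.mul hQc
    rw [← parab_smul σ b hQc, ← parab_add σ b hZ hc]
    refine strict_core hσ hb hC hL hu hw hψ (hZ.add hc) hz0 hρ Hu Hw ?_
    intro y hy hne
    have h1 := hmax y hy
    have h2 := mul_pos hκ (hQpos y hne)
    simp only [hQ0]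
    linarith
  have hlim : Tendsto (fun n : ℕ => parab σ b Z z0 + (1 / ((n:ℝ) + 1)) * parab σ b Q z0) atTop
      (𝓝 (parab σ b Z z0 + 0 * parab σ b Q z0)) :=
    tendsto_const_nhds.add (tendsto_one_div_add_atTop_nhds_zero_nat.mul_const _)
  have := ge_of_tendsto' hlim fun n => hκ _ (by positivity)
  simpa using this

end Core3

section Growth

open Filter Topology

variable {k d m : ℕ}

lemma le_maxNe {i j : Fin m} (hij : j ≠ i) (f : Fin m → ℝ) : f j ≤ maxNe i f :=
  le_ciSup (f := fun j : {j : Fin m // j ≠ i} => f (j : Fin m))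
    (Set.finite_range _).bddAbove ⟨j, hij⟩

lemma maxNe_lt (hm : 2 ≤ m) {i : Fin m} {f : Fin m → ℝ} {c : ℝ} (h : ∀ j, j ≠ i → f j < c) :
    maxNe i f < c := by
  have : Nontrivial (Fin m) := Fin.nontrivial_iff_two_le.2 hm
  obtain ⟨j0, hj0⟩ := exists_ne i
  have : Nonempty {j : Fin m // j ≠ i} := ⟨⟨j0, hj0⟩⟩
  obtain ⟨j, hj⟩ := exists_eq_ciSup_of_finite (f := fun j : {j : Fin m // j ≠ i} => f (j : Fin m))
  unfold maxNe
  rw [← hj]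
  exact h j j.2

lemma obstacle {T : ℝ} {σ : ℝ → EuclideanSpace ℝ (Fin k) → Fin k → Fin d → ℝ}
    {b : ℝ → EuclideanSpace ℝ (Fin k) → EuclideanSpace ℝ (Fin k)}
    {ψ : Fin m → ℝ → EuclideanSpace ℝ (Fin k) → ℝ}
    {g : Fin m → Fin m → ℝ → EuclideanSpace ℝ (Fin k) → ℝ}
    {w : Fin m → ℝ → EuclideanSpace ℝ (Fin k) → ℝ}
    (hg : ∀ i j, ContinuousOn
      (fun p : ℝ × EuclideanSpace ℝ (Fin k) => g i j p.1 p.2) (Icc 0 T ×ˢ univ))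
    (hw : ∀ i, ContinuousOn
      (fun p : ℝ × EuclideanSpace ℝ (Fin k) => w i p.1 p.2) (Icc 0 T ×ˢ univ))
    (hsup : IsViscositySupersolution T σ b ψ g w) {i j : Fin m} (hij : j ≠ i)
    {t : ℝ} (ht : t ∈ Ico (0:ℝ) T) (x : EuclideanSpace ℝ (Fin k)) :
    w j t x - g i j t x ≤ w i t x := by
  by_contra hlt
  push Not at hlt
  set dom : Set (ℝ × EuclideanSpace ℝ (Fin k)) := Icc (0:ℝ) T ×ˢ univ with hdom
  set z0 : ℝ × EuclideanSpace ℝ (Fin k) := (t, x) with hz0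
  have hz0d : z0 ∈ dom := ⟨⟨ht.1, ht.2.le⟩, mem_univ _⟩
  have hev : ∀ᶠ y in 𝓝[dom] z0, w i y.1 y.2 < w j y.1 y.2 - g i j y.1 y.2 ∧ y.1 < T := by
    refine Filter.Eventually.and ?_ ?_
    · exact (hw i z0 hz0d).eventually_lt ((hw j z0 hz0d).sub (hg i j z0 hz0d)) hlt
    · exact mem_nhdsWithin_of_mem_nhds
        ((isOpen_lt continuous_fst continuous_const).mem_nhds (by exact ht.2))
  obtain ⟨ρ', hρ', hball⟩ := Metric.mem_nhdsWithin_iff.1 hev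
  set ρ := ρ' / 2 with hρdef
  have hρ : 0 < ρ := by positivity
  have hin : ∀ y ∈ dom ∩ Metric.closedBall z0 ρ,
      w i y.1 y.2 < w j y.1 y.2 - g i j y.1 y.2 ∧ y.1 < T := fun y hy =>
    hball ⟨Metric.closedBall_subset_ball (half_lt_self hρ') hy.2, hy.1⟩
  have hD : IsCompact (dom ∩ Metric.closedBall z0 ρ) :=
    (isCompact_closedBall z0 ρ).inter_left (isClosed_Icc.prod isClosed_univ)
  have hz0D : z0 ∈ dom ∩ Metric.closedBall z0 ρ := ⟨hz0d, Metric.mem_closedBall_self hρ.le⟩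
  have hwD := (hw i).mono (inter_subset_left : dom ∩ Metric.closedBall z0 ρ ⊆ dom)
  obtain ⟨C, hC⟩ := hD.exists_bound_of_continuousOn hwD
  have hC0 : 0 ≤ C := (norm_nonneg _).trans (hC z0 hz0D)
  set n := (2 * C + 1) / ρ^2 with hn
  have hn0 : 0 < n := by positivity
  set Q : ℝ × EuclideanSpace ℝ (Fin k) → ℝ := fun y => n * ((y.1 - z0.1)^2 + ‖y.2 - z0.2‖^2)
    with hQ
  have hQc : ContDiff ℝ 2 Q := by
    refine contDiff_const.mul (ContDiff.add ?_ ?_)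
    · exact (contDiff_fst.sub contDiff_const).pow 2
    · exact (contDiff_snd.sub contDiff_const).norm_sq ℝ
  obtain ⟨y, hyD, hymin⟩ := hD.exists_isMinOn ⟨z0, hz0D⟩ (hwD.add hQc.continuous.continuousOn)
  have hymin' : ∀ y' ∈ dom ∩ Metric.closedBall z0 ρ,
    w i y.1 y.2 + Q y ≤ w i y'.1 y'.2 + Q y' := fun y' hy' => hymin hy'
  have hyb : y ∈ Metric.ball z0 ρ := by
    rw [Metric.mem_ball, dist_eq_norm]
    by_contra hge
    push Not at hge
    have h1 := hymin' z0 hz0D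
    have h2 : Q z0 = 0 := by simp [hQ]
    have h3 := abs_le.1 (hC z0 hz0D)
    have h4 := abs_le.1 (hC y hyD)
    have h5 : ρ^2 ≤ (y.1 - z0.1)^2 + ‖y.2 - z0.2‖^2 := by
      rw [Prod.norm_def] at hge
      rcases le_max_iff.1 hge with h | h
      · have : ρ^2 ≤ ‖(y - z0).1‖^2 := by gcongr
        rw [Real.norm_eq_abs, sq_abs] at this
        have h6 := sq_nonneg ‖y.2 - z0.2‖
        have h7 : (y - z0).1 = y.1 - z0.1 := rfl
        rw [h7] at this
        linarith
      · have : ρ^2 ≤ ‖(y - z0).2‖^2 := by gcongr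
        have h6 := sq_nonneg (y.1 - z0.1)
        have h7 : (y - z0).2 = y.2 - z0.2 := rfl
        rw [h7] at this
        linarith
    have h6 : 2 * C + 1 ≤ Q y := by
      have : n * ρ^2 = 2 * C + 1 := by rw [hn]; field_simp
      rw [← this]
      simp only [hQ]
      gcongr
    linarith [h3.2, h4.1]
  have hyin := hin y hyD
  have hs := hsup i y.1 ⟨hyD.1.1.1, hyin.2⟩ y.2 (fun y' => w i y.1 y.2 + Q y - Q y')
    (contDiff_const.sub hQc) (by simp) (by
      show ∀ᶠ y' in 𝓝[dom] y, _
      have : Metric.ball z0 ρ ∈ 𝓝[dom] y :=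
        mem_nhdsWithin_of_mem_nhds (Metric.isOpen_ball.mem_nhds hyb)
      filter_upwards [this, self_mem_nhdsWithin] with y' h1 h2
      have := hymin' y' ⟨h2, Metric.ball_subset_closedBall h1⟩
      linarith)
  have h1 := (le_min_iff.1 hs).1
  have h2 := le_maxNe hij (fun j => -(g i j y.1 y.2) + w j y.1 y.2)
  linarith [hyin.1]

lemma inClassC_bound {T : ℝ} {v : ℝ → EuclideanSpace ℝ (Fin k) → ℝ} (hv : InClassC T v) :
    ∃ (A : ℝ) (N : ℕ), 0 ≤ A ∧ ∀ n, N ≤ n → ∀ t ∈ Icc (0:ℝ) T, ∀ x,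
      |v t x| ≤ A * (1 + ‖x‖^2)^n := by
  obtain ⟨hc, C, γ, hb⟩ := hv
  have hD : IsCompact (Icc (0:ℝ) T ×ˢ Metric.closedBall (0 : EuclideanSpace ℝ (Fin k)) 1) :=
    isCompact_Icc.prod (isCompact_closedBall _ _)
  obtain ⟨C2, hC2⟩ := hD.exists_bound_of_continuousOn
    (hc.mono (prod_mono subset_rfl (subset_univ _)))
  refine ⟨2 * |C| + |C2|, ⌈|γ|⌉₊, by positivity, ?_⟩
  intro n hn t ht x
  have hP : 1 ≤ (1 + ‖x‖^2)^n := one_le_pow₀ (by nlinarith [sq_nonneg ‖x‖])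
  rcases le_total ‖x‖ 1 with h | h
  · have h1 := hC2 (t, x) ⟨ht, by simpa using h⟩
    have h1' : |v t x| ≤ C2 := h1
    calc |v t x| ≤ |C2| * 1 := by rw [mul_one]; exact h1'.trans (le_abs_self _)
      _ ≤ (2 * |C| + |C2|) * (1 + ‖x‖^2)^n := by
        gcongr
        linarith [abs_nonneg C]
  · have h1 := hb t ht x
    have h2 : ‖x‖^γ ≤ (1 + ‖x‖^2)^n := by
      have e1 : ‖x‖^γ ≤ ‖x‖^(n:ℝ) := by
        apply Real.rpow_le_rpow_of_exponent_le h
        calc γ ≤ |γ| := le_abs_self _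
          _ ≤ (⌈|γ|⌉₊ : ℝ) := Nat.le_ceil _
          _ ≤ n := by exact_mod_cast hn
      rw [Real.rpow_natCast] at e1
      refine e1.trans ?_
      gcongr
      nlinarith
    have h3 : 0 ≤ ‖x‖^γ := by positivity
    calc |v t x| ≤ C * (1 + ‖x‖^γ) := h1
      _ ≤ |C| * (1 + ‖x‖^γ) := by gcongr; exact le_abs_self _
      _ ≤ |C| * (2 * (1 + ‖x‖^2)^n) := by gcongr; linarith
      _ ≤ (2 * |C| + |C2|) * (1 + ‖x‖^2)^n := by
        have : 0 ≤ |C2| * (1 + ‖x‖^2)^n := by positivity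
        linarith

/-- the growth function -/
def zeta (lam : ℝ) (n : ℕ) (y : ℝ × EuclideanSpace ℝ (Fin k)) : ℝ :=
  Real.exp (-lam * y.1) * (1 + ‖y.2‖^2)^(n + 2)

lemma zeta_contDiff (lam : ℝ) (n : ℕ) : ContDiff ℝ 2 (zeta (k := k) lam n) := by
  refine ContDiff.mul ?_ ?_
  · exact (contDiff_const.mul contDiff_fst).exp
  · exact (contDiff_const.add (contDiff_snd.norm_sq ℝ)).pow _

lemma norm_line (x c : EuclideanSpace ℝ (Fin k)) (s : ℝ) :
    ‖x + s • c‖^2 = ‖x‖^2 + 2 * s * inner ℝ x c + s^2 * ‖c‖^2 := by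
  rw [norm_add_sq_real, inner_smul_right, norm_smul, mul_pow, Real.norm_eq_abs, sq_abs]
  ring

lemma hasDerivAt_line (x c : EuclideanSpace ℝ (Fin k)) :
    HasDerivAt (fun s : ℝ => 1 + ‖x + s • c‖^2) (2 * inner ℝ x c) 0 := by
  simp only [norm_line]
  have h1 : HasDerivAt (fun s : ℝ => 2 * s * inner ℝ x c) (2 * 1 * inner ℝ x c) 0 :=
    ((hasDerivAt_id (0:ℝ)).const_mul 2).mul_const _
  have h2 : HasDerivAt (fun s : ℝ => s^2 * ‖c‖^2) ((2 * 0) * ‖c‖^2) 0 := by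
    have := (hasDerivAt_pow 2 (0:ℝ)).mul_const (‖c‖^2)
    simpa using this
  have := ((h1.const_add (‖x‖^2)).add h2).const_add 1
  simpa using this

lemma zeta_dx (lam : ℝ) (n : ℕ) (y : ℝ × EuclideanSpace ℝ (Fin k))
    (c : EuclideanSpace ℝ (Fin k)) :
    fderiv ℝ (zeta lam n) y (0, c) = Real.exp (-lam * y.1) *
      ((n + 2) * (1 + ‖y.2‖^2)^(n + 1) * (2 * inner ℝ y.2 c)) := by
  have hd : DifferentiableAt ℝ (zeta (k := k) lam n) y :=
    (zeta_contDiff lam n).differentiable (by norm_num) y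
  rw [← hd.lineDeriv_eq_fderiv]
  have h := ((hasDerivAt_line y.2 c).pow (n + 2)).const_mul (Real.exp (-lam * y.1))
  have h2 : HasLineDerivAt ℝ (zeta lam n) _ y (0, c) :=
    HasDerivAt.congr_deriv (f := fun s : ℝ => zeta lam n (y + s • ((0:ℝ), c)))
      (by simpa [zeta] using h) rfl
  rw [h2.lineDeriv]
  simp

lemma zeta_dxx (lam : ℝ) (n : ℕ) (y : ℝ × EuclideanSpace ℝ (Fin k))
    (c : EuclideanSpace ℝ (Fin k)) :
    fderiv ℝ (fderiv ℝ (zeta lam n)) y (0, c) (0, c) = Real.exp (-lam * y.1) *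
      ((n + 2) * ((n + 1) * (1 + ‖y.2‖^2)^n * (2 * inner ℝ y.2 c)^2
        + (1 + ‖y.2‖^2)^(n + 1) * (2 * ‖c‖^2))) := by
  rw [← fderiv_apply_fderiv (zeta_contDiff lam n)]
  have hd : DifferentiableAt ℝ (fun z => fderiv ℝ (zeta (k := k) lam n) z (0, c)) y :=
    (((zeta_contDiff lam n).fderiv_right (m := 1) (by norm_num)).clm_apply
      contDiff_const).differentiable (by norm_num) y
  rw [← hd.lineDeriv_eq_fderiv]
  simp only [zeta_dx]
  have hi : HasDerivAt (fun s : ℝ => inner ℝ (y.2 + s • c) c) (‖c‖^2) 0 := by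
    simp only [inner_add_left, real_inner_smul_left, real_inner_self_eq_norm_sq]
    have := ((hasDerivAt_id (0:ℝ)).mul_const (‖c‖^2)).const_add (inner ℝ y.2 c)
    simpa using this
  have h := ((((hasDerivAt_line y.2 c).pow (n + 1)).const_mul ((n:ℝ) + 2)).mul
    (hi.const_mul 2)).const_mul (Real.exp (-lam * y.1))
  have h2 : HasLineDerivAt ℝ (fun z : ℝ × EuclideanSpace ℝ (Fin k) => Real.exp (-lam * z.1) *
      ((n + 2) * (1 + ‖z.2‖^2)^(n + 1) * (2 * inner ℝ z.2 c))) _ y (0, c) :=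
    HasDerivAt.congr_deriv (f := fun s : ℝ => (fun z : ℝ × EuclideanSpace ℝ (Fin k) =>
      Real.exp (-lam * z.1) * ((n + 2) * (1 + ‖z.2‖^2)^(n + 1) * (2 * inner ℝ z.2 c)))
        (y + s • ((0:ℝ), c)))
      (by simpa using h) rfl
  rw [h2.lineDeriv]
  simp
  ring

lemma zeta_dt (lam : ℝ) (n : ℕ) (y : ℝ × EuclideanSpace ℝ (Fin k)) :
    fderiv ℝ (zeta lam n) y (1, 0) = -lam * zeta lam n y := by
  have hd : DifferentiableAt ℝ (zeta (k := k) lam n) y :=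
    (zeta_contDiff lam n).differentiable (by norm_num) y
  rw [← hd.lineDeriv_eq_fderiv]
  have h0 : HasDerivAt (fun s : ℝ => -lam * (y.1 + s)) (-lam * 1) 0 :=
    ((hasDerivAt_id (0:ℝ)).const_add y.1).const_mul (-lam)
  have h : HasDerivAt (fun s : ℝ => Real.exp (-lam * (y.1 + s)) * (1 + ‖y.2‖^2)^(n + 2))
      (Real.exp (-lam * (y.1 + 0)) * (-lam * 1) * (1 + ‖y.2‖^2)^(n + 2)) 0 :=
    h0.exp.mul_const _
  have h2 : HasLineDerivAt ℝ (zeta lam n) _ y (1, 0) :=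
    HasDerivAt.congr_deriv (f := fun s : ℝ => zeta lam n (y + s • ((1:ℝ), 0)))
      (by simpa [zeta] using h) rfl
  rw [h2.lineDeriv]
  simp [zeta]
  ring

lemma zeta_neg {T C : ℝ} {σ : ℝ → EuclideanSpace ℝ (Fin k) → Fin k → Fin d → ℝ}
    {b : ℝ → EuclideanSpace ℝ (Fin k) → EuclideanSpace ℝ (Fin k)}
    (hσ : ∀ p r, ContinuousOn (fun q : ℝ × EuclideanSpace ℝ (Fin k) => σ q.1 q.2 p r)
      (Icc 0 T ×ˢ univ))
    (hb : ContinuousOn (fun q : ℝ × EuclideanSpace ℝ (Fin k) => b q.1 q.2) (Icc 0 T ×ˢ univ))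
    (hL : ∀ t ∈ Icc (0 : ℝ) T, ∀ x x' : EuclideanSpace ℝ (Fin k),
      (∑ p : Fin k, ∑ r : Fin d, |σ t x p r - σ t x' p r|) + ‖b t x - b t x'‖ ≤ C * ‖x - x'‖)
    (n : ℕ) :
    ∃ lam : ℝ, ∀ y ∈ Icc (0:ℝ) T ×ˢ (univ : Set (EuclideanSpace ℝ (Fin k))),
      parab σ b (zeta lam n) y < 0 := by
  have hcpt : IsCompact (Icc (0:ℝ) T ×ˢ ({0} : Set (EuclideanSpace ℝ (Fin k)))) :=
    isCompact_Icc.prod isCompact_singleton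
  obtain ⟨C2, hC2⟩ := hcpt.exists_bound_of_continuousOn
    ((coef_continuousOn hσ hb).mono (prod_mono subset_rfl (subset_univ _)))
  set A := 2 * (C^2 + C2^2) with hA
  have hA0 : 0 ≤ A := by positivity
  have hcoef : ∀ y ∈ Icc (0:ℝ) T ×ˢ (univ : Set (EuclideanSpace ℝ (Fin k))),
      ‖coef σ b y‖^2 ≤ A * (1 + ‖y.2‖^2) := by
    intro y hy
    have h1 := coef_lip hL hy.1 y.2 0
    have h2 := hC2 (y.1, 0) ⟨hy.1, rfl⟩
    have h3 : ‖coef σ b y‖ ≤ C * ‖y.2‖ + C2 := by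
      have := norm_le_norm_add_norm_sub' (coef σ b (y.1, y.2)) (coef σ b (y.1, 0))
      rw [sub_zero] at h1
      have e : coef σ b (y.1, y.2) = coef σ b y := rfl
      rw [e] at this h1
      linarith
    have h4 : ‖coef σ b y‖^2 ≤ (C * ‖y.2‖ + C2)^2 := by gcongr
    have h5 : (C * ‖y.2‖ + C2)^2 ≤ A * (1 + ‖y.2‖^2) := by
      rw [hA]
      nlinarith [sq_nonneg (C * ‖y.2‖ - C2), sq_nonneg (C2 * ‖y.2‖), sq_nonneg C]
    linarith
  set N : ℝ := (n:ℝ) + 2 with hN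
  set κ := (1/2) * (d * (N * (4 * N * A + 2 * A))) + N * (1 + A) with hκ
  refine ⟨κ + 1, ?_⟩
  intro y hy
  have hy1 := hcoef y hy
  set P := 1 + ‖y.2‖^2 with hP
  have hP0 : 0 < P := by positivity
  set e := Real.exp (-(κ + 1) * y.1) with he
  have he0 : 0 < e := Real.exp_pos _
  have hn0 : (0:ℝ) ≤ n := Nat.cast_nonneg n
  have hN0 : 0 < N := by positivity
  rw [parab_eq σ b (zeta_contDiff _ n), zeta_dt, zeta_dx]
  simp only [zeta_dxx]
  have hz : zeta (κ + 1) n y = e * P^(n+2) := rfl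
  rw [hz, ← he, ← hP, ← hN]
  have hr : ∀ r : Fin d, e * (N * ((n + 1) * P^n * (2 * inner ℝ y.2 (col σ r y))^2
        + P^(n + 1) * (2 * ‖col σ r y‖^2))) ≤ (e * P^(n+2)) * (N * (4 * N * A + 2 * A)) := by
    intro r
    have h1 : ‖col σ r y‖^2 ≤ A * P := by
      have h := coef_col0 (σ := σ) (b := b) r y
      have : ‖col σ r y‖^2 ≤ ‖coef σ b y‖^2 := by gcongr
      linarith
    have h2 : (2 * inner ℝ y.2 (col σ r y))^2 ≤ 4 * (P * (A * P)) := by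
      have h3 := abs_real_inner_le_norm y.2 (col σ r y)
      have h4 : |inner ℝ y.2 (col σ r y)|^2 ≤ (‖y.2‖ * ‖col σ r y‖)^2 := by gcongr
      rw [sq_abs, mul_pow] at h4
      have h5 : ‖y.2‖^2 * ‖col σ r y‖^2 ≤ P * (A * P) := by
        gcongr
        linarith
      rw [mul_pow]
      linarith
    have h3 : ((n:ℝ) + 1) * P^n * (2 * inner ℝ y.2 (col σ r y))^2
        ≤ N * P^n * (4 * (P * (A * P))) := by
      gcongr
      linarith
    have h4 : P^(n + 1) * (2 * ‖col σ r y‖^2) ≤ P^(n+1) * (2 * (A * P)) := by gcongr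
    calc _ ≤ e * (N * (N * P^n * (4 * (P * (A * P))) + P^(n+1) * (2 * (A * P)))) := by
          gcongr
      _ = _ := by ring
  have hsum := Finset.sum_le_sum (s := Finset.univ) fun r _ => hr r
  simp only [Finset.sum_const, Finset.card_univ, Fintype.card_fin, nsmul_eq_mul] at hsum
  have hdrift : e * (N * P^(n + 1) * (2 * inner ℝ y.2 (b y.1 y.2)))
      ≤ (e * P^(n+2)) * (N * (1 + A)) := by
    have h1 : ‖b y.1 y.2‖^2 ≤ A * P := by
      have h := coef_b0 (σ := σ) (b := b) y
      have : ‖b y.1 y.2‖^2 ≤ ‖coef σ b y‖^2 := by gcongr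
      linarith
    have h2 : 2 * inner ℝ y.2 (b y.1 y.2) ≤ P + A * P := by
      have := real_inner_le_norm y.2 (b y.1 y.2)
      nlinarith [sq_nonneg (‖y.2‖ - ‖b y.1 y.2‖)]
    calc _ ≤ e * (N * P^(n + 1) * (P + A * P)) := by gcongr
      _ = _ := by ring
  have hpos : 0 < e * P^(n+2) := by positivity
  have : -(κ + 1) * (e * P^(n+2)) = -((e * P^(n+2)) * ((1/2) * (d * (N * (4 * N * A + 2 * A)))))
      - (e * P^(n+2)) * (N * (1 + A)) - e * P^(n+2) := by rw [hκ]; ring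
  linarith

end Growth

section Final

open Filter Topology

variable {k d m : ℕ}

lemma index_choice {m : ℕ} {α M : ℝ} (hα : 0 < α) {u w : Fin m → ℝ} {g : Fin m → Fin m → ℝ}
    (hnn : ∀ i j, 0 ≤ g i j)
    (htri : ∀ i j l, j ≠ i → l ≠ i → l ≠ j → g i l < g i j + g j l)
    (hal : ∀ i j, i ≠ j → α < g i j + g j i)
    (hobs : ∀ i j, j ≠ i → w j - g i j ≤ w i)
    (hM : ∀ i, u i - w i ≤ M) (hex : ∃ i, u i - w i = M) :
    ∃ i, u i - w i = M ∧ ∀ j, j ≠ i → u j - g i j < u i := by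
  by_contra hcon
  push Not at hcon
  obtain ⟨i0, hi0⟩ := hex
  have hne : Nonempty {i : Fin m // u i - w i = M} := ⟨⟨i0, hi0⟩⟩
  obtain ⟨⟨i, hi⟩, hmax⟩ := Finite.exists_max (fun i : {i : Fin m // u i - w i = M} => u i)
  have hstep : ∀ i, u i - w i = M → (∀ l, u l - w l = M → u l ≤ u i) →
      ∃ j, j ≠ i ∧ u j - w j = M ∧ g i j = 0 ∧ u j = u i := by
    intro i hi hmx
    obtain ⟨j, hji, hj⟩ := hcon i hi
    have h1 := hobs i j hji
    have h2 := hM j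
    have h3 : u j - w j = M := by linarith
    have h4 := hmx j h3
    have h5 := hnn i j
    exact ⟨j, hji, h3, by linarith, by linarith⟩
  have hmax' : ∀ l, u l - w l = M → u l ≤ u i := fun l hl => hmax ⟨l, hl⟩
  obtain ⟨j, hji, hjM, hgij, huj⟩ := hstep i hi hmax'
  obtain ⟨l, hlj, hlM, hgjl, hul⟩ := hstep j hjM (fun l hl => huj ▸ hmax' l hl)
  by_cases hli : l = i
  · subst hli
    have := hal l j hji.symm
    linarith
  · have := htri i j l hji hli hlj
    have := hnn i l
    linarith

end Final

open Filter Topology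

/-- **Comparison principle** for the system of variational inequalities with inter-connected
obstacles: if `(u_1,…,u_m)` is a viscosity subsolution and `(w_1,…,w_m)` a viscosity
supersolution of `min{v_i − max_{j≠i}(−g_{ij}+v_j), −∂_t v_i − A v_i − ψ_i} = 0`,
`v_i(T,·) ≡ 0`, and both `m`-tuples are continuous of polynomial growth, then
`u_i ≤ w_i` everywhere on `[0,T] × ℝ^k` for every `i`. -/
theorem comparison_principle {k d m : ℕ} {T α : ℝ}
    (hT : 0 < T) (hk : 1 ≤ k) (hd : 1 ≤ d) (hm : 2 ≤ m) (hα : 0 < α)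
    (σ : ℝ → EuclideanSpace ℝ (Fin k) → Fin k → Fin d → ℝ)
    (b : ℝ → EuclideanSpace ℝ (Fin k) → EuclideanSpace ℝ (Fin k))
    (ψ : Fin m → ℝ → EuclideanSpace ℝ (Fin k) → ℝ)
    (g : Fin m → Fin m → ℝ → EuclideanSpace ℝ (Fin k) → ℝ)
    (H : PDEHyps T α σ b ψ g)
    (u w : Fin m → ℝ → EuclideanSpace ℝ (Fin k) → ℝ)
    (huC : ∀ i, InClassC T (u i)) (hwC : ∀ i, InClassC T (w i))
    (huT : ∀ i x, u i T x = 0) (hwT : ∀ i x, w i T x = 0)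
    (hsub : IsViscositySubsolution T σ b ψ g u)
    (hsup : IsViscositySupersolution T σ b ψ g w) :
    ∀ i : Fin m, ∀ t ∈ Icc (0 : ℝ) T, ∀ x : EuclideanSpace ℝ (Fin k),
      u i t x ≤ w i t x := by
  intro i1 t1 ht1 x1
  by_contra hlt
  push Not at hlt
  obtain ⟨C0, hL0⟩ := H.lipschitz
  set C := max C0 0 with hCdef
  have hC : 0 ≤ C := le_max_right _ _
  have hL : ∀ t ∈ Icc (0 : ℝ) T, ∀ x x' : EuclideanSpace ℝ (Fin k),
      (∑ p : Fin k, ∑ r : Fin d, |σ t x p r - σ t x' p r|) + ‖b t x - b t x'‖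
        ≤ C * ‖x - x'‖ := fun t ht x x' =>
    (hL0 t ht x x').trans (mul_le_mul_of_nonneg_right (le_max_left _ _) (norm_nonneg _))
  choose Au Nu hAu hNu using fun i => inClassC_bound (huC i)
  choose Aw Nw hAw hNw using fun i => inClassC_bound (hwC i)
  set n := ∑ i, (Nu i + Nw i) with hn
  set A := ∑ i, (Au i + Aw i) with hA
  have hA0 : 0 ≤ A := Finset.sum_nonneg fun i _ => add_nonneg (hAu i) (hAw i)
  have hgrow : ∀ i, ∀ t ∈ Icc (0:ℝ) T, ∀ x, u i t x - w i t x ≤ A * (1 + ‖x‖^2)^n := by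
    intro i t ht x
    have hi : Nu i + Nw i ≤ n :=
      Finset.single_le_sum (f := fun i => Nu i + Nw i) (fun _ _ => Nat.zero_le _)
        (Finset.mem_univ i)
    have hi2 : Au i + Aw i ≤ A :=
      Finset.single_le_sum (f := fun i => Au i + Aw i)
        (fun i _ => add_nonneg (hAu i) (hAw i)) (Finset.mem_univ i)
    have h1 := abs_le.1 (hNu i n (by omega) t ht x)
    have h2 := abs_le.1 (hNw i n (by omega) t ht x)
    have h3 : (Au i + Aw i) * (1 + ‖x‖^2)^n ≤ A * (1 + ‖x‖^2)^n := by gcongr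
    linarith [h1.2, h2.1]
  obtain ⟨lam, hlam⟩ := zeta_neg H.σ_cont H.b_cont hL n
  have hζpos : ∀ y : ℝ × EuclideanSpace ℝ (Fin k), 0 < zeta lam n y := fun y => by
    unfold zeta; positivity
  set dom : Set (ℝ × EuclideanSpace ℝ (Fin k)) := Icc (0:ℝ) T ×ˢ univ with hdom
  set δ := u i1 t1 x1 - w i1 t1 x1 with hδ
  have hδ0 : 0 < δ := by linarith
  set θ := δ / (2 * zeta lam n (t1, x1)) with hθ
  have hθ0 : 0 < θ := div_pos hδ0 (mul_pos two_pos (hζpos _))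
  have hθ1 : θ * zeta lam n (t1, x1) = δ / 2 := by
    rw [hθ]
    have := (hζpos (t1, x1)).ne'
    field_simp
  set Z : ℝ × EuclideanSpace ℝ (Fin k) → ℝ := fun y => θ * zeta lam n y with hZdef
  have hZ : ContDiff ℝ 2 Z := contDiff_const.mul (zeta_contDiff lam n)
  set Φ : Fin m → ℝ × EuclideanSpace ℝ (Fin k) → ℝ :=
    fun i y => u i y.1 y.2 - Z y - w i y.1 y.2 with hΦ
  have hΦc : ∀ i, ContinuousOn (Φ i) dom := fun i =>
    ((huC i).1.sub hZ.continuous.continuousOn).sub (hwC i).1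
  obtain ⟨e0, he0, hexp⟩ : ∃ e0 : ℝ, 0 < e0 ∧ ∀ t ∈ Icc (0:ℝ) T, e0 ≤ Real.exp (-lam * t) := by
    refine ⟨Real.exp (-(|lam| * T)), Real.exp_pos _, ?_⟩
    intro t ht
    apply Real.exp_le_exp.2
    have h1 : lam * t ≤ |lam| * t := mul_le_mul_of_nonneg_right (le_abs_self _) ht.1
    have h2 : |lam| * t ≤ |lam| * T := mul_le_mul_of_nonneg_left ht.2 (abs_nonneg _)
    linarith
  set R := max (A / (θ * e0)) ‖x1‖ with hR
  have hfar : ∀ i, ∀ y ∈ dom, R < ‖y.2‖ → Φ i y ≤ 0 := by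
    intro i y hy hRy
    have h1 := hgrow i y.1 hy.1 y.2
    have h2 : A / (θ * e0) ≤ ‖y.2‖ := (le_max_left _ _).trans hRy.le
    rw [div_le_iff₀ (by positivity)] at h2
    have h3 : ‖y.2‖ ≤ (1 + ‖y.2‖^2)^2 := by nlinarith [sq_nonneg (‖y.2‖ - 1), sq_nonneg ‖y.2‖]
    have h4 : A ≤ (1 + ‖y.2‖^2)^2 * (θ * e0) :=
      h2.trans (mul_le_mul_of_nonneg_right h3 (by positivity))
    have h5 : A * (1 + ‖y.2‖^2)^n ≤ (1 + ‖y.2‖^2)^2 * (θ * e0) * (1 + ‖y.2‖^2)^n := by gcongr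
    have h6 : (1 + ‖y.2‖^2)^2 * (θ * e0) * (1 + ‖y.2‖^2)^n ≤ Z y := by
      have : (1 + ‖y.2‖^2)^2 * (θ * e0) * (1 + ‖y.2‖^2)^n
          = θ * (e0 * (1 + ‖y.2‖^2)^(n+2)) := by ring
      rw [this]
      simp only [hZdef, zeta]
      have := hexp y.1 hy.1
      gcongr
    simp only [hΦ]
    linarith
  have hDc : IsCompact (Icc (0:ℝ) T ×ˢ Metric.closedBall (0 : EuclideanSpace ℝ (Fin k)) R) :=
    isCompact_Icc.prod (isCompact_closedBall _ _)
  have hz1 : (t1, x1) ∈ Icc (0:ℝ) T ×ˢ Metric.closedBall (0 : EuclideanSpace ℝ (Fin k)) R :=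
    ⟨ht1, by simp [hR]⟩
  have hsubD : Icc (0:ℝ) T ×ˢ Metric.closedBall (0 : EuclideanSpace ℝ (Fin k)) R ⊆ dom :=
    prod_mono subset_rfl (subset_univ _)
  choose Y hYD hYmax using fun i => hDc.exists_isMaxOn ⟨_, hz1⟩ ((hΦc i).mono hsubD)
  have hneI : Nonempty (Fin m) := ⟨i1⟩
  obtain ⟨i2, hi2⟩ := Finite.exists_max (fun i => Φ i (Y i))
  set z0 := Y i2 with hz0
  have hz0d : z0 ∈ dom := hsubD (hYD i2)
  have hpos : 0 < Φ i2 z0 := by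
    have h1 : Φ i1 (t1, x1) ≤ Φ i1 (Y i1) := hYmax i1 hz1
    have h2 := hi2 i1
    have h3 : Φ i1 (t1, x1) = δ / 2 := by
      simp only [hΦ, hZdef, hθ1]
      linarith
    have h4 : Φ i1 (Y i1) ≤ Φ i2 z0 := h2
    linarith
  have hglob : ∀ i, ∀ y ∈ dom, Φ i y ≤ Φ i2 z0 := by
    intro i y hy
    by_cases hyR : ‖y.2‖ ≤ R
    · have h1 : Φ i y ≤ Φ i (Y i) := hYmax i ⟨hy.1, by simpa using hyR⟩
      exact h1.trans (hi2 i)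
    · exact (hfar i y hy (not_le.1 hyR)).trans hpos.le
  have ht0 : z0.1 ∈ Ico (0:ℝ) T := by
    refine ⟨hz0d.1.1, lt_of_le_of_ne hz0d.1.2 ?_⟩
    intro h
    have h2 : Φ i2 z0 = - Z z0 := by
      simp only [hΦ, h, huT, hwT]
      ring
    have h3 : 0 < Z z0 := mul_pos hθ0 (hζpos _)
    linarith
  obtain ⟨i, hiM, hiobs⟩ := index_choice (M := Φ i2 z0 + Z z0) hα
    (u := fun i => u i z0.1 z0.2) (w := fun i => w i z0.1 z0.2)
    (g := fun i j => g i j z0.1 z0.2)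
    (fun i j => H.g_nonneg i j z0.1 hz0d.1 z0.2)
    (fun i j l h1 h2 h3 => H.g_triangle i j l h1 h2 h3 z0.1 hz0d.1 z0.2)
    (fun i j h => H.g_alpha i j h z0.1 hz0d.1 z0.2)
    (fun i j h => obstacle H.g_cont (fun i => (hwC i).1) hsup h ht0 z0.2)
    (fun i => by
      have := hglob i z0 hz0d
      simp only [hΦ] at this ⊢
      linarith)
    ⟨i2, by simp only [hΦ]; ring⟩
  have hev : ∀ᶠ y in 𝓝[dom] z0, (∀ j, j ≠ i → u j y.1 y.2 - g i j y.1 y.2 < u i y.1 y.2) ∧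
      y.1 < T := by
    refine Filter.Eventually.and ?_ ?_
    · refine eventually_all.2 fun j => ?_
      by_cases hji : j = i
      · exact Eventually.of_forall fun y h => absurd hji h
      · filter_upwards [(((huC j).1 z0 hz0d).sub (H.g_cont i j z0 hz0d)).eventually_lt
          ((huC i).1 z0 hz0d) (hiobs j hji)] with y hy _
        exact hy
    · exact mem_nhdsWithin_of_mem_nhds
        ((isOpen_lt continuous_fst continuous_const).mem_nhds (by exact ht0.2))
  obtain ⟨ρ, hρ, hball⟩ := Metric.mem_nhdsWithin_iff.1 hev
  have hfinal := core (u := fun y => u i y.1 y.2) (w := fun y => w i y.1 y.2)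
    (ψ := fun y => ψ i y.1 y.2) H.σ_cont H.b_cont hC hL (huC i).1 (hwC i).1 (H.ψ_cont i) hZ
    hz0d hρ
    (by
      intro z hz hzb φ hφ hφz hmin
      obtain ⟨h1, h2⟩ := hball ⟨hzb, hz⟩
      have h3 := hsub i z.1 ⟨hz.1.1, h2⟩ z.2 φ hφ hφz hmin
      have h4 : maxNe i (fun j => -(g i j z.1 z.2) + u j z.1 z.2) < u i z.1 z.2 :=
        maxNe_lt hm fun j hj => by
          have := h1 j hj
          linarith
      rcases min_le_iff.1 h3 with h | h
      · linarith
      · unfold parab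
        linarith)
    (by
      intro z hz hzb φ hφ hφz hmax
      obtain ⟨h1, h2⟩ := hball ⟨hzb, hz⟩
      have h3 := hsup i z.1 ⟨hz.1.1, h2⟩ z.2 φ hφ hφz hmax
      have h4 := (le_min_iff.1 h3).2
      unfold parab
      linarith)
    (by
      intro y hy
      have := hglob i y hy
      simp only [hΦ] at this hiM ⊢
      linarith)
  rw [hZdef, parab_smul σ b (zeta_contDiff lam n)] at hfinal
  have h1 := hlam z0 hz0d
  have h2 := mul_neg_of_pos_of_neg hθ0 h1
  linarith

end SwitchingPDE

end
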